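/- arXiv:1205.3004 — 3 statements merged into one kernel-verified Lean document; each statement's English description precedes it below -/
import Mathlib

section
/- Equality holds in the Brunn-Minkowski inequality μ_d(αA + βB) = (α μ_d(A)^{1/d} + β μ_d(B)^{1/d})^d for convex bodies A, B in R^d and α, β > 0 if and only if A and B are homothetic. -/
open MeasureTheory Pointwise Set

/-- `f` restricts to a continuous, positive probability density on `(a, b)`. -/
structure IsPosDensityOn (f : ℝ → ℝ) (a b : ℝ) : Prop where
  lt : a < b
  continuousOn : ContinuousOn f (Ioo a b)
  pos : ∀ x ∈ Ioo a b, 0 < f x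
  integrableOn : IntegrableOn f (Ioo a b)
  integral_eq_one : ∫ x in Ioo a b, f x = 1

theorem IsPosDensityOn.exists_quantile {f : ℝ → ℝ} {a b : ℝ} (h : IsPosDensityOn f a b) :
    ∃ z : ℝ → ℝ, z '' Ioo 0 1 = Ioo a b ∧ StrictMonoOn z (Ioo 0 1) ∧
      ∀ τ ∈ Ioo (0 : ℝ) 1, HasDerivAt z (f (z τ))⁻¹ τ := by
  obtain ⟨hab, hf, hpos, hInt, h1⟩ := h
  rw [← integrableOn_Ioc_iff_integrableOn_Ioo,
    ← intervalIntegrable_iff_integrableOn_Ioc_of_le hab.le] at hInt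
  rw [← integral_Ioc_eq_integral_Ioo, ← intervalIntegral.integral_of_le hab.le] at h1
  set F : ℝ → ℝ := fun s => ∫ x in a..s, f x with hF
  have hFc : ContinuousOn F (Icc a b) := by
    have := intervalIntegral.continuousOn_primitive_interval (μ := volume) (f := f) (a := a) (b := b)
      (by rwa [uIcc_of_le hab.le, integrableOn_Icc_iff_integrableOn_Ioc,
        ← intervalIntegrable_iff_integrableOn_Ioc_of_le hab.le])
    rwa [uIcc_of_le hab.le] at this
  have hFd : ∀ s ∈ Ioo a b, HasDerivAt F (f s) s := fun s hs =>
    intervalIntegral.integral_hasDerivAt_right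
      (hInt.mono_set (by rw [uIcc_of_le hab.le, uIcc_of_le hs.1.le]
                         exact Icc_subset_Icc_right hs.2.le))
      (hf.stronglyMeasurableAtFilter isOpen_Ioo s hs) (hf.continuousAt (isOpen_Ioo.mem_nhds hs))
  have hFm : StrictMonoOn F (Icc a b) := by
    refine strictMonoOn_of_deriv_pos (convex_Icc a b) hFc fun s hs => ?_
    rw [interior_Icc] at hs
    rw [(hFd s hs).deriv]
    exact hpos s hs
  have hFa : F a = 0 := intervalIntegral.integral_same
  have hmaps : MapsTo F (Ioo a b) (Ioo 0 1) := fun s hs =>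
    ⟨hFa ▸ hFm (left_mem_Icc.2 hab.le) (Ioo_subset_Icc_self hs) hs.1,
      h1 ▸ hFm (Ioo_subset_Icc_self hs) (right_mem_Icc.2 hab.le) hs.2⟩
  have hsurj : SurjOn F (Ioo a b) (Ioo 0 1) := by
    have := intermediate_value_Ioo hab.le hFc
    rwa [hFa, show F b = 1 from h1] at this
  have hFm' := hFm.mono Ioo_subset_Icc_self
  have hbij : BijOn F (Ioo a b) (Ioo 0 1) := ⟨hmaps, hFm'.injOn, hsurj⟩
  have hinv := hbij.invOn_invFunOn
  set z := Function.invFunOn F (Ioo a b) with hz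
  have hzbij : BijOn z (Ioo 0 1) (Ioo a b) := hbij.symm hinv.symm
  have hzm : StrictMonoOn z (Ioo 0 1) := by
    intro s hs t ht hst
    rw [← hFm'.lt_iff_lt (hzbij.mapsTo hs) (hzbij.mapsTo ht), hinv.2 hs, hinv.2 ht]
    exact hst
  refine ⟨z, hzbij.image_eq, hzm, fun τ hτ => ?_⟩
  have hzτ := hzbij.mapsTo hτ
  refine HasDerivAt.of_local_left_inverse ?_ (hFd _ hzτ) (hpos _ hzτ).ne' ?_
  · refine continuousAt_of_monotoneOn_of_image_mem_nhds hzm.monotoneOn (isOpen_Ioo.mem_nhds hτ) ?_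
    rw [hzbij.image_eq]
    exact isOpen_Ioo.mem_nhds hzτ
  · filter_upwards [isOpen_Ioo.mem_nhds hτ] with y hy using hinv.2 hy


theorem one_le_weighted_inv_mul {l p q : ℝ} (h0 : 0 < l) (h1 : l < 1) (hp : 0 < p) (hq : 0 < q) :
    1 ≤ ((1 - l) * p⁻¹ + l * q⁻¹) * (p ^ (1 - l) * q ^ l) := by
  have h := Real.geom_mean_le_arith_mean2_weighted (sub_nonneg.2 h1.le) h0.le
    (inv_nonneg.2 hp.le) (inv_nonneg.2 hq.le) (by ring)
  rw [Real.inv_rpow hp.le, Real.inv_rpow hq.le, ← mul_inv] at h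
  have hpos : 0 < p ^ (1 - l) * q ^ l := by positivity
  calc (1 : ℝ) = (p ^ (1 - l) * q ^ l)⁻¹ * (p ^ (1 - l) * q ^ l) := (inv_mul_cancel₀ hpos.ne').symm
    _ ≤ _ := by gcongr

theorem eq_of_weighted_inv_mul_eq_one {l p q : ℝ} (h0 : 0 < l) (h1 : l < 1) (hp : 0 < p)
    (hq : 0 < q) (h : ((1 - l) * p⁻¹ + l * q⁻¹) * (p ^ (1 - l) * q ^ l) = 1) : p = q := by
  rw [← inv_inj, ← Real.geom_mean_eq_arith_mean2_weighted_iff_of_pos (sub_pos.2 h1) h0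
    (inv_nonneg.2 hp.le) (inv_nonneg.2 hq.le) (by ring), Real.inv_rpow hp.le, Real.inv_rpow hq.le,
    ← mul_inv]
  exact (eq_inv_of_mul_eq_one_left h).symm

theorem IsPosDensityOn.prekopa_leindler {f g : ℝ → ℝ} {a b a' b' : ℝ} (hf : IsPosDensityOn f a b)
    (hg : IsPosDensityOn g a' b') {l : ℝ} (h0 : 0 < l) (h1 : l < 1) {h : ℝ → ENNReal}
    (hh : ∀ s ∈ Ioo a b, ∀ t ∈ Ioo a' b',
      ENNReal.ofReal (f s ^ (1 - l) * g t ^ l) ≤ h ((1 - l) * s + l * t)) :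
    1 ≤ ∫⁻ x, h x ∧ (∫⁻ x, h x ≤ 1 → ∃ c, b' = b + c ∧
      ∫ x in Ioo a' b', x * g x = (∫ x in Ioo a b, x * f x) + c) := by
  obtain ⟨z, hzi, hzm, hzd⟩ := hf.exists_quantile
  obtain ⟨w, hwi, hwm, hwd⟩ := hg.exists_quantile
  have hz : ∀ τ ∈ Ioo (0 : ℝ) 1, z τ ∈ Ioo a b := fun τ hτ => hzi ▸ mem_image_of_mem z hτ
  have hw : ∀ τ ∈ Ioo (0 : ℝ) 1, w τ ∈ Ioo a' b' := fun τ hτ => hwi ▸ mem_image_of_mem w hτ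
  have hzc : ContinuousOn z (Ioo 0 1) := fun τ hτ => (hzd τ hτ).continuousAt.continuousWithinAt
  have hwc : ContinuousOn w (Ioo 0 1) := fun τ hτ => (hwd τ hτ).continuousAt.continuousWithinAt
  have hfz : ContinuousOn (fun τ => f (z τ)) (Ioo 0 1) := hf.continuousOn.comp hzc hz
  have hgw : ContinuousOn (fun τ => g (w τ)) (Ioo 0 1) := hg.continuousOn.comp hwc hw
  have hfp : ∀ τ ∈ Ioo (0 : ℝ) 1, 0 < f (z τ) := fun τ hτ => hf.pos _ (hz τ hτ)
  have hgp : ∀ τ ∈ Ioo (0 : ℝ) 1, 0 < g (w τ) := fun τ hτ => hg.pos _ (hw τ hτ)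
  set φ : ℝ → ℝ := fun τ => (1 - l) * z τ + l * w τ
  set φ' : ℝ → ℝ := fun τ => (1 - l) * (f (z τ))⁻¹ + l * (g (w τ))⁻¹
  set ψ : ℝ → ℝ := fun τ => φ' τ * (f (z τ) ^ (1 - l) * g (w τ) ^ l) with hψ
  have hφ'c : ContinuousOn φ' (Ioo 0 1) :=
    (continuousOn_const.mul (hfz.inv₀ fun τ hτ => (hfp τ hτ).ne')).add
      (continuousOn_const.mul (hgw.inv₀ fun τ hτ => (hgp τ hτ).ne'))
  have hψc : ContinuousOn ψ (Ioo 0 1) :=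
    hφ'c.mul ((hfz.rpow_const fun τ hτ => Or.inl (hfp τ hτ).ne').mul
      (hgw.rpow_const fun τ hτ => Or.inl (hgp τ hτ).ne'))
  have h1' := sub_pos.2 h1
  have hφ'p : ∀ τ ∈ Ioo (0 : ℝ) 1, 0 < φ' τ := fun τ hτ => by
    have := hfp τ hτ
    have := hgp τ hτ
    positivity
  have hφm : StrictMonoOn φ (Ioo 0 1) := fun s hs t ht hst => by
    have := hzm hs ht hst
    have := hwm hs ht hst
    simp only [φ]
    gcongr
  have hφd : ∀ τ ∈ Ioo (0 : ℝ) 1, HasDerivWithinAt φ (φ' τ) (Ioo 0 1) τ := fun τ hτ =>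
    (((hzd τ hτ).const_mul _).add ((hwd τ hτ).const_mul _)).hasDerivWithinAt
  have hone : ∀ τ ∈ Ioo (0 : ℝ) 1, 1 ≤ ψ τ := fun τ hτ =>
    one_le_weighted_inv_mul h0 h1 (hfp τ hτ) (hgp τ hτ)
  have hψh : ∫⁻ τ in Ioo (0 : ℝ) 1, ENNReal.ofReal (ψ τ) ≤ ∫⁻ x, h x := by
    refine le_trans ?_ (setLIntegral_le_lintegral (φ '' Ioo 0 1) h)
    rw [lintegral_image_eq_lintegral_abs_deriv_mul measurableSet_Ioo hφd hφm.injOn]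
    refine setLIntegral_mono' measurableSet_Ioo fun τ hτ => ?_
    rw [abs_of_pos (hφ'p τ hτ), hψ, ENNReal.ofReal_mul (hφ'p τ hτ).le]
    gcongr
    exact hh _ (hz τ hτ) _ (hw τ hτ)
  have hI : ∫⁻ _ in Ioo (0 : ℝ) 1, (1 : ENNReal) = 1 := by simp
  have hle : ∀ᵐ τ ∂(volume.restrict (Ioo (0 : ℝ) 1)), (1 : ENNReal) ≤ ENNReal.ofReal (ψ τ) :=
    (ae_restrict_iff' measurableSet_Ioo).2 (.of_forall fun τ hτ =>
      ENNReal.one_le_ofReal.2 (hone τ hτ))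
  refine ⟨hI.symm.le.trans ((lintegral_mono_ae hle).trans hψh), fun hInt => ?_⟩
  have hae := ae_eq_of_ae_le_of_lintegral_le hle (by simp)
    (hψc.aemeasurable measurableSet_Ioo).ennreal_ofReal (by rw [hI]; exact hψh.trans hInt)
  have hψ1 : EqOn ψ (fun _ => 1) (Ioo 0 1) := by
    refine Measure.eqOn_open_of_ae_eq (μ := volume) ?_ isOpen_Ioo hψc continuousOn_const
    filter_upwards [hae] with τ hτ
    exact ENNReal.ofReal_eq_one.1 hτ.symm
  have hfg : ∀ τ ∈ Ioo (0 : ℝ) 1, f (z τ) = g (w τ) := fun τ hτ =>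
    eq_of_weighted_inv_mul_eq_one h0 h1 (hfp τ hτ) (hgp τ hτ) (hψ1 hτ)
  obtain ⟨c, hc⟩ := isOpen_Ioo.exists_is_const_of_deriv_eq_zero (f := fun τ => w τ - z τ)
    isPreconnected_Ioo
    (fun τ hτ => ((hwd τ hτ).sub (hzd τ hτ)).differentiableAt.differentiableWithinAt)
    (fun τ hτ => by simp [((hwd τ hτ).fun_sub (hzd τ hτ)).deriv, hfg τ hτ])
  have hwz : ∀ τ ∈ Ioo (0 : ℝ) 1, w τ = z τ + c := fun τ hτ => by linarith [hc τ hτ]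
  have moment : ∀ {f z : ℝ → ℝ} {a b : ℝ}, z '' Ioo 0 1 = Ioo a b → StrictMonoOn z (Ioo 0 1) →
      (∀ τ ∈ Ioo (0 : ℝ) 1, HasDerivAt z (f (z τ))⁻¹ τ) → (∀ x ∈ Ioo a b, 0 < f x) →
      ∫ x in Ioo a b, x * f x = ∫ τ in Ioo (0 : ℝ) 1, z τ := by
    intro f z a b hi hm hd hp
    rw [← hi, integral_image_eq_integral_abs_deriv_smul measurableSet_Ioo
      (fun τ hτ => (hd τ hτ).hasDerivWithinAt) hm.injOn]
    refine setIntegral_congr_fun measurableSet_Ioo fun τ hτ => ?_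
    have := hp (z τ) (hi ▸ mem_image_of_mem z hτ)
    simp only [smul_eq_mul, abs_of_pos (inv_pos.2 this)]
    field_simp
  refine ⟨c, ?_, ?_⟩
  · have : Ioo a' b' = Ioo (a + c) (b + c) := by
      rw [← hwi, ← image_add_const_Ioo, ← hzi, image_image]
      exact image_congr hwz
    rw [← csSup_Ioo hg.lt, this, csSup_Ioo (by linarith [hf.lt])]
  · rw [moment hwi hwm hwd hg.pos, moment hzi hzm hzd hf.pos,
      setIntegral_congr_fun measurableSet_Ioo hwz]
    have hzint : IntegrableOn z (Ioo 0 1) := by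
      refine Integrable.of_bound (hzc.aestronglyMeasurable measurableSet_Ioo) (max |a| |b|) ?_
      refine (ae_restrict_iff' measurableSet_Ioo).2 (.of_forall fun τ hτ => ?_)
      exact abs_le_max_abs_abs (hz τ hτ).1.le (hz τ hτ).2.le
    rw [integral_add hzint (by simp)]
    simp

/-- The multiplicative Brunn–Minkowski inequality for compact convex subsets of `F`. -/
def MulBrunnMinkowski (F : Type*) [AddCommGroup F] [Module ℝ F] [TopologicalSpace F]
    [MeasureSpace F] : Prop :=
  ∀ A B : Set F, IsCompact A → Convex ℝ A → IsCompact B → Convex ℝ B → ∀ l : ℝ, 0 < l → l < 1 →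
    volume.real A ^ (1 - l) * volume.real B ^ l ≤ volume.real ((1 - l) • A + l • B)

theorem IsCompact.slice {F : Type*} [TopologicalSpace F] [T2Space F] {A : Set (ℝ × F)}
    (hA : IsCompact A) (t : ℝ) : IsCompact (Prod.mk t ⁻¹' A) :=
  (hA.image continuous_snd).of_isClosed_subset
    (hA.isClosed.preimage (Continuous.prodMk_right t)) fun y hy => ⟨(t, y), hy, rfl⟩

theorem Convex.slice {F : Type*} [AddCommGroup F] [Module ℝ F] {A : Set (ℝ × F)}
    (hA : Convex ℝ A) (t : ℝ) : Convex ℝ (Prod.mk t ⁻¹' A) := by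
  intro x hx y hy a b ha hb hab
  have := hA hx hy ha hb hab
  simpa [← add_mul, hab] using this

theorem MulBrunnMinkowski.slice_le {F : Type*} [NormedAddCommGroup F] [NormedSpace ℝ F]
    [MeasureSpace F] [IsFiniteMeasureOnCompacts (volume : Measure F)] {A B : Set (ℝ × F)}
    (hF : MulBrunnMinkowski F) (hA : IsCompact A) (hAc : Convex ℝ A)
    (hB : IsCompact B) (hBc : Convex ℝ B) {l : ℝ} (h0 : 0 < l) (h1 : l < 1) (s t : ℝ) :
    volume.real (Prod.mk s ⁻¹' A) ^ (1 - l) * volume.real (Prod.mk t ⁻¹' B) ^ l ≤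
      volume.real (Prod.mk ((1 - l) * s + l * t) ⁻¹' ((1 - l) • A + l • B)) := by
  refine (hF _ _ (hA.slice s) (hAc.slice s) (hB.slice t) (hBc.slice t) l h0 h1).trans ?_
  refine measureReal_mono ?_ (((hA.smul _).add (hB.smul _)).slice _).measure_lt_top.ne
  rintro _ ⟨_, ⟨x, hx, rfl⟩, _, ⟨y, hy, rfl⟩, rfl⟩
  exact ⟨_, ⟨_, hx, rfl⟩, _, ⟨_, hy, rfl⟩, by simp⟩

section Slices

variable {F : Type*} [NormedAddCommGroup F] [NormedSpace ℝ F] [FiniteDimensional ℝ F]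
  [MeasureSpace F] [BorelSpace F] [(volume : Measure F).IsAddHaarMeasure] {A B : Set (ℝ × F)}

theorem integrable_mul_slice (hA : IsCompact A) {φ : ℝ → ℝ} (hφ : Continuous φ) :
    Integrable (fun t => φ t * volume.real (Prod.mk t ⁻¹' A)) ∧
      ∫ p in A, φ p.1 = ∫ t, φ t * volume.real (Prod.mk t ⁻¹' A) := by
  have hInt : Integrable (A.indicator fun p : ℝ × F => φ p.1) (volume.prod volume) :=
    (integrable_indicator_iff hA.measurableSet).2
      ((hφ.comp continuous_fst).continuousOn.integrableOn_compact hA)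
  have key : (fun t => ∫ y, A.indicator (fun p : ℝ × F => φ p.1) (t, y)) =
      fun t => φ t * volume.real (Prod.mk t ⁻¹' A) := by
    ext t
    have : (fun y => A.indicator (fun p : ℝ × F => φ p.1) (t, y)) =
        (Prod.mk t ⁻¹' A).indicator fun _ => φ t := by
      rfl
    rw [this, integral_indicator_const _ (hA.slice t).measurableSet, smul_eq_mul, mul_comm]
  refine ⟨key ▸ hInt.integral_prod_left, ?_⟩
  rw [← integral_indicator hA.measurableSet, Measure.volume_eq_prod, integral_prod _ hInt, key]

theorem MulBrunnMinkowski.exists_isPosDensityOn (hF : MulBrunnMinkowski F) (hA : IsCompact A)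
    (hAc : Convex ℝ A) (hAi : (interior A).Nonempty) :
    ∃ a b, IsPosDensityOn (fun t => volume.real (Prod.mk t ⁻¹' A) / volume.real A) a b ∧
      (∀ p ∈ A, p.1 ≤ b) ∧ Ioo a b ⊆ Prod.fst '' A ∧
      ∫ p in A, p.1 =
        volume.real A * ∫ t in Ioo a b, t * (volume.real (Prod.mk t ⁻¹' A) / volume.real A) := by
  set S := Prod.fst '' interior A
  set V := fun t => volume.real (Prod.mk t ⁻¹' A)
  have hM : 0 < volume.real A :=
    ENNReal.toReal_pos (Measure.measure_pos_of_nonempty_interior _ hAi).ne' hA.measure_lt_top.ne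
  have hSo : IsOpen S := isOpenMap_fst _ isOpen_interior
  have hSn : S.Nonempty := hAi.image _
  have hSA : S ⊆ Prod.fst '' A := image_mono interior_subset
  have hSc : IsConnected S := ⟨hSn, (hAc.interior.isPreconnected).image _ continuous_fst.continuousOn⟩
  have hbdd := (hA.image continuous_fst).isBounded.subset hSA
  have hS : S = Ioo (sInf S) (sSup S) := by
    refine Subset.antisymm ?_ (hSc.Ioo_csInf_csSup_subset hbdd.bddBelow hbdd.bddAbove)
    rw [← interior_Icc]
    exact interior_maximal (subset_Icc_csInf_csSup hbdd.bddBelow hbdd.bddAbove) hSo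
  set a := sInf S
  set b := sSup S
  have hab : a < b := by rwa [hS, nonempty_Ioo] at hSn
  have hAab : ∀ p ∈ A, p.1 ∈ Icc a b := by
    intro p hp
    have hp' : p ∈ closure (interior A) := by
      rw [hAc.closure_interior_eq_closure_of_nonempty_interior hAi]
      exact subset_closure hp
    rw [← closure_Ioo hab.ne, ← hS]
    exact image_closure_subset_closure_image continuous_fst (mem_image_of_mem _ hp')
  have hVpos : ∀ t ∈ Ioo a b, 0 < V t := by
    intro t ht
    rw [← hS] at ht
    obtain ⟨⟨t, y⟩, hy, rfl⟩ := ht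
    refine ENNReal.toReal_pos (Measure.measure_pos_of_nonempty_interior _ ⟨y, ?_⟩).ne'
      (hA.slice t).measure_lt_top.ne
    exact interior_maximal (preimage_mono interior_subset)
      (isOpen_interior.preimage (Continuous.prodMk_right t)) hy
  have hVc : ContinuousOn V (Ioo a b) := by
    have hlog : ConcaveOn ℝ (Ioo a b) fun t => Real.log (V t) := by
      refine concaveOn_iff_forall_pos.2 ⟨convex_Ioo a b, fun s hs t ht x l hx hl hxl => ?_⟩
      obtain rfl : x = 1 - l := by linarith
      have h := hF.slice_le hA hAc hA hAc hl (by linarith) s t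
      rw [← hAc.add_smul hx.le hl.le, sub_add_cancel, one_smul] at h
      have hs' := hVpos s hs
      have ht' := hVpos t ht
      have := Real.log_le_log (by positivity) h
      rwa [Real.log_mul (by positivity) (by positivity), Real.log_rpow hs', Real.log_rpow ht'] at this
    exact ((hlog.continuousOn isOpen_Ioo).rexp).congr fun t ht => (Real.exp_log (hVpos t ht)).symm
  have hV0 : ∀ t, t ∉ Icc a b → V t = 0 := by
    intro t ht
    have : Prod.mk t ⁻¹' A = ∅ := eq_empty_of_forall_notMem fun y hy => ht (hAab _ hy)
    simp [V, this]
  have hIoo : ∀ φ : ℝ → ℝ, Continuous φ → ∫ p in A, φ p.1 = ∫ t in Ioo a b, φ t * V t := by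
    intro φ hφ
    rw [(integrable_mul_slice hA hφ).2, ← integral_Icc_eq_integral_Ioo]
    exact (setIntegral_eq_integral_of_forall_compl_eq_zero fun t ht =>
      mul_eq_zero_of_right _ (hV0 t ht)).symm
  refine ⟨a, b, ⟨hab, hVc.div_const _, fun t ht => div_pos (hVpos t ht) hM, ?_, ?_⟩,
    fun p hp => (hAab p hp).2, hS ▸ hSA, ?_⟩
  · have := (integrable_mul_slice hA (continuous_const (y := (1 : ℝ)))).1
    simp only [one_mul] at this
    exact (this.div_const _).integrableOn
  · have := hIoo _ (continuous_const (y := (1 : ℝ)))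
    simp only [one_mul, setIntegral_const, smul_eq_mul, mul_one] at this
    rw [integral_div, ← this, div_self hM.ne']
  · rw [hIoo (fun t => t) continuous_id, ← integral_const_mul]
    refine integral_congr_ae (.of_forall fun t => ?_)
    simp only [V]
    field_simp

theorem MulBrunnMinkowski.prod_body (hF : MulBrunnMinkowski F) (hA : IsCompact A)
    (hAc : Convex ℝ A) (hAi : (interior A).Nonempty) (hB : IsCompact B)
    (hBc : Convex ℝ B) (hBi : (interior B).Nonempty) {l : ℝ} (h0 : 0 < l) (h1 : l < 1) :
    volume.real A ^ (1 - l) * volume.real B ^ l ≤ volume.real ((1 - l) • A + l • B) ∧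
      (volume.real A = 1 → volume.real B = 1 → volume.real ((1 - l) • A + l • B) ≤ 1 →
        ∃ c, ∫ p in B, p.1 = (∫ p in A, p.1) + c ∧
          ∀ m, (∀ p ∈ A, p.1 ≤ m) → ∀ q ∈ B, q.1 ≤ m + c) := by
  have hMA : 0 < volume.real A :=
    ENNReal.toReal_pos (Measure.measure_pos_of_nonempty_interior _ hAi).ne' hA.measure_lt_top.ne
  have hMB : 0 < volume.real B :=
    ENNReal.toReal_pos (Measure.measure_pos_of_nonempty_interior _ hBi).ne' hB.measure_lt_top.ne
  obtain ⟨a, b, hf, -, hSA, hmA⟩ := hF.exists_isPosDensityOn hA hAc hAi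
  obtain ⟨a', b', hg, hBb, -, hmB⟩ := hF.exists_isPosDensityOn hB hBc hBi
  set K := (1 - l) • A + l • B
  have hK : IsCompact K := (hA.smul _).add (hB.smul _)
  set N := volume.real A ^ (1 - l) * volume.real B ^ l with hN
  have hNp : 0 < N := by positivity
  have hKint : ∫⁻ t, ENNReal.ofReal (volume.real (Prod.mk t ⁻¹' K) / N) =
      ENNReal.ofReal (volume.real K / N) := by
    have := integrable_mul_slice hK (continuous_const (y := (1 : ℝ)))
    simp only [one_mul, setIntegral_const, smul_eq_mul, mul_one] at this
    rw [this.2, ← integral_div, ofReal_integral_eq_lintegral_ofReal (this.1.div_const _)]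
    exact .of_forall fun t => by positivity
  obtain ⟨hle, heq⟩ := hf.prekopa_leindler hg h0 h1
    (h := fun t => ENNReal.ofReal (volume.real (Prod.mk t ⁻¹' K) / N)) fun s _ t _ => by
      refine ENNReal.ofReal_le_ofReal ?_
      rw [Real.div_rpow measureReal_nonneg hMA.le, Real.div_rpow measureReal_nonneg hMB.le,
        div_mul_div_comm]
      gcongr
      exact hF.slice_le hA hAc hB hBc h0 h1 s t
  rw [hKint] at hle heq
  refine ⟨by rwa [ENNReal.one_le_ofReal, one_le_div hNp] at hle, fun hA1 hB1 hK1 => ?_⟩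
  have hN1 : N = 1 := by simp [hN, hA1, hB1]
  obtain ⟨c, hc, hm⟩ := heq (by rwa [hN1, div_one, ENNReal.ofReal_le_one])
  refine ⟨c, by rw [hmA, hmB, hm, hA1, hB1]; ring, fun m hmle q hq => ?_⟩
  have hbm : b ≤ m := by
    refine le_of_forall_lt fun x hx => ?_
    obtain ⟨y, hy, hyb⟩ := exists_between (max_lt hx hf.lt)
    obtain ⟨p, hp, rfl⟩ := hSA ⟨(le_max_right _ _).trans_lt hy, hyb⟩
    exact ((le_max_left _ _).trans_lt hy).trans_le (hmle p hp)
  linarith [hBb q hq]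

theorem MulBrunnMinkowski.prod (hF : MulBrunnMinkowski F) : MulBrunnMinkowski (ℝ × F) := by
  intro A B hA hAc hB hBc l h0 h1
  have interior_nonempty : ∀ {C : Set (ℝ × F)}, Convex ℝ C → volume.real C ≠ 0 →
      (interior C).Nonempty := by
    intro C hC hne
    by_contra! h
    have h0 : (volume : Measure (ℝ × F)) (frontier C) = 0 :=
      hC.addHaar_frontier (volume.prod volume)
    rw [frontier, h, sdiff_empty] at h0
    simp [measureReal_def, measure_mono_null subset_closure h0] at hne
  by_cases hA0 : volume.real A = 0
  · rw [hA0, Real.zero_rpow (sub_pos.2 h1).ne', zero_mul]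
    exact measureReal_nonneg
  by_cases hB0 : volume.real B = 0
  · rw [hB0, Real.zero_rpow h0.ne', mul_zero]
    exact measureReal_nonneg
  exact (hF.prod_body hA hAc (interior_nonempty hAc hA0) hB hBc (interior_nonempty hBc hB0) h0 h1).1

end Slices

theorem measureReal_image_continuousLinearEquiv {E F : Type*} [NormedAddCommGroup E]
    [NormedSpace ℝ E] [MeasureSpace E] [NormedAddCommGroup F] [NormedSpace ℝ F] [MeasureSpace F]
    [BorelSpace F] (e : E ≃L[ℝ] F) (he : MeasurePreserving e) {A : Set E} (hA : IsCompact A) :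
    volume.real (e '' A) = volume.real A := by
  rw [measureReal_def, measureReal_def, ← he.measure_preimage
    (hA.image e.continuous).measurableSet.nullMeasurableSet, preimage_image_eq _ e.injective]

theorem image_continuousLinearEquiv_smul_add_smul {E F : Type*} [NormedAddCommGroup E]
    [NormedSpace ℝ E] [NormedAddCommGroup F] [NormedSpace ℝ F] (e : E ≃L[ℝ] F) (A B : Set E)
    (a b : ℝ) : e '' (a • A + b • B) = a • e '' A + b • e '' B := by
  rw [image_add, image_smul_set, image_smul_set]

theorem MulBrunnMinkowski.of_equiv {E F : Type*} [NormedAddCommGroup E]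
    [NormedSpace ℝ E] [MeasureSpace E] [NormedAddCommGroup F] [NormedSpace ℝ F] [MeasureSpace F]
    [BorelSpace F] (hF : MulBrunnMinkowski F) (e : E ≃L[ℝ] F) (he : MeasurePreserving e) :
    MulBrunnMinkowski E := by
  intro A B hA hAc hB hBc l h0 h1
  have := hF _ _ (hA.image e.continuous) (hAc.linear_image e.toLinearMap)
    (hB.image e.continuous) (hBc.linear_image e.toLinearMap) l h0 h1
  erw [← image_continuousLinearEquiv_smul_add_smul e A B,
    measureReal_image_continuousLinearEquiv e he hA,
    measureReal_image_continuousLinearEquiv e he hB,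
    measureReal_image_continuousLinearEquiv e he ((hA.smul _).add (hB.smul _))] at this
  exact this

theorem measurePreserving_consEquivL_symm (n : ℕ) :
    MeasurePreserving (Fin.consEquivL ℝ fun _ : Fin (n + 1) => ℝ).symm := by
  convert! volume_preserving_piFinSuccAbove (fun _ : Fin (n + 1) => ℝ) 0

theorem mulBrunnMinkowski_pi (n : ℕ) : MulBrunnMinkowski (Fin n → ℝ) := by
  induction n with
  | zero =>
    intro A B _ _ _ _ l h0 h1
    rcases A.eq_empty_or_nonempty with rfl | hA
    · simp [Real.zero_rpow (sub_pos.2 h1).ne']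
    rcases B.eq_empty_or_nonempty with rfl | hB
    · simp [Real.zero_rpow h0.ne']
    have hvol : ∀ C : Set (Fin 0 → ℝ), C.Nonempty → volume.real C = 1 := fun C hC => by
      rw [Subsingleton.eq_univ_of_nonempty hC, Measure.volume_pi_eq_dirac 0]
      simp
    simp [hvol A hA, hvol B hB, hvol _ ((hA.smul_set (a := 1 - l)).add (hB.smul_set (a := l)))]
  | succ n ih => exact ih.prod.of_equiv _ (measurePreserving_consEquivL_symm n)

theorem exists_equiv_prod_fst_eq_inner {n : ℕ} {u : EuclideanSpace ℝ (Fin (n + 1))}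
    (hu : ‖u‖ = 1) : ∃ e : EuclideanSpace ℝ (Fin (n + 1)) ≃L[ℝ] ℝ × (Fin n → ℝ),
      MeasurePreserving e ∧ ∀ x, (e x).1 = inner ℝ u x := by
  obtain ⟨b, hb⟩ := Orthonormal.exists_orthonormalBasis_extension_of_card_eq (𝕜 := ℝ)
    (E := EuclideanSpace ℝ (Fin (n + 1))) (ι := Fin (n + 1)) (by simp) (v := fun _ => u) (s := {0})
    ⟨fun _ => hu, fun i j hij => (hij (Subsingleton.elim i j)).elim⟩
  refine ⟨b.repr.toContinuousLinearEquiv.trans ((EuclideanSpace.equiv (Fin (n + 1)) ℝ).trans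
    (Fin.consEquivL ℝ fun _ : Fin (n + 1) => ℝ).symm), ?_, fun x => ?_⟩
  · exact (measurePreserving_consEquivL_symm n).comp
      ((PiLp.volume_preserving_ofLp (Fin (n + 1))).comp b.measurePreserving_repr)
  · rw [← hb 0 rfl, ← b.repr_apply_apply]
    rfl

section Equality

variable {n : ℕ} {A B : Set (EuclideanSpace ℝ (Fin (n + 1)))}

theorem inner_le_of_brunnMinkowski_eq (hA : IsCompact A)
    (hAc : Convex ℝ A) (hAi : (interior A).Nonempty) (hB : IsCompact B)
    (hBc : Convex ℝ B) (hBi : (interior B).Nonempty) {l : ℝ} (h0 : 0 < l) (h1 : l < 1)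
    (hA1 : volume.real A = 1) (hB1 : volume.real B = 1)
    (hK : volume.real ((1 - l) • A + l • B) ≤ 1) {u : EuclideanSpace ℝ (Fin (n + 1))}
    (hu : ‖u‖ = 1) {m : ℝ} (hm : ∀ p ∈ A, inner ℝ u p ≤ m) {q : EuclideanSpace ℝ (Fin (n + 1))}
    (hq : q ∈ B) :
    inner ℝ u q ≤ m + inner ℝ u ((∫ p in B, p) - ∫ p in A, p) := by
  obtain ⟨e, he, heu⟩ := exists_equiv_prod_fst_eq_inner hu
  have hInt : ∀ {C : Set (EuclideanSpace ℝ (Fin (n + 1)))}, IsCompact C →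
      IsCompact (e '' C) ∧ ∫ p in e '' C, p.1 = inner ℝ u (∫ p in C, p) := by
    intro C hC
    refine ⟨hC.image e.continuous, ?_⟩
    rw [he.setIntegral_image_emb e.toHomeomorph.measurableEmbedding]
    simp_rw [heu]
    exact (innerSL ℝ u).integral_comp_comm (continuousOn_id.integrableOn_compact hC)
  have hInterior : ∀ {C : Set (EuclideanSpace ℝ (Fin (n + 1)))}, (interior C).Nonempty →
      (interior (e '' C)).Nonempty := by
    intro C hC
    have := e.toHomeomorph.image_interior C
    exact this ▸ hC.image e
  obtain ⟨c, hc, hs⟩ := ((mulBrunnMinkowski_pi n).prod_body (hInt hA).1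
    (hAc.linear_image e.toLinearMap) (hInterior hAi) (hInt hB).1 (hBc.linear_image e.toLinearMap)
    (hInterior hBi) h0 h1).2
    (by rw [measureReal_image_continuousLinearEquiv e he hA, hA1])
    (by rw [measureReal_image_continuousLinearEquiv e he hB, hB1])
    (by rwa [← image_continuousLinearEquiv_smul_add_smul e A B,
      measureReal_image_continuousLinearEquiv e he ((hA.smul _).add (hB.smul _))])
  rw [(hInt hA).2, (hInt hB).2] at hc
  have := hs m (by rintro _ ⟨p, hp, rfl⟩; exact heu p ▸ hm p hp) (e q) ⟨q, hq, rfl⟩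
  rw [heu] at this
  rw [inner_sub_right]
  linarith

theorem subset_vadd_of_brunnMinkowski_eq (hA : IsCompact A)
    (hAc : Convex ℝ A) (hAi : (interior A).Nonempty) (hB : IsCompact B)
    (hBc : Convex ℝ B) (hBi : (interior B).Nonempty) {l : ℝ} (h0 : 0 < l) (h1 : l < 1)
    (hA1 : volume.real A = 1) (hB1 : volume.real B = 1)
    (hK : volume.real ((1 - l) • A + l • B) ≤ 1) :
    B ⊆ ((∫ p in B, p) - ∫ p in A, p) +ᵥ A := by
  intro q hq
  set x := (∫ p in B, p) - ∫ p in A, p with hx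
  rw [mem_vadd_set_iff_neg_vadd_mem]
  by_contra hqA
  obtain ⟨f, m, hfA, hfq⟩ := geometric_hahn_banach_closed_point hAc hA.isClosed hqA
  set v := (InnerProductSpace.toDual ℝ _).symm f
  have hv : ∀ y, f y = inner ℝ v y := fun y => (InnerProductSpace.toDual_symm_apply).symm
  obtain ⟨p₀, hp₀⟩ := hAi.mono interior_subset
  have hv0 : v ≠ 0 := by
    intro h
    have h₁ := hfA p₀ hp₀
    rw [hv, h, inner_zero_left] at h₁ hfq
    linarith
  have hvn : 0 < ‖v‖ := norm_pos_iff.2 hv0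
  have := inner_le_of_brunnMinkowski_eq hA hAc hAi hB hBc hBi h0 h1 hA1 hB1 hK
    (u := ‖v‖⁻¹ • v) (by simp [norm_smul, hvn.ne']) (m := ‖v‖⁻¹ * m) (fun p hp => by
      rw [real_inner_smul_left, ← hv]
      gcongr
      exact (hfA p hp).le) hq
  rw [real_inner_smul_left, real_inner_smul_left, ← mul_add, mul_le_mul_iff_right₀ (by positivity),
    ← hx, ← hv, ← hv] at this
  rw [vadd_eq_add, map_add, map_neg] at hfq
  linarith

theorem eq_vadd_of_brunnMinkowski_eq (hA : IsCompact A)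
    (hAc : Convex ℝ A) (hAi : (interior A).Nonempty) (hB : IsCompact B)
    (hBc : Convex ℝ B) (hBi : (interior B).Nonempty) {l : ℝ} (h0 : 0 < l) (h1 : l < 1)
    (hA1 : volume.real A = 1) (hB1 : volume.real B = 1)
    (hK : volume.real ((1 - l) • A + l • B) ≤ 1) :
    B = ((∫ p in B, p) - ∫ p in A, p) +ᵥ A := by
  refine (subset_vadd_of_brunnMinkowski_eq hA hAc hAi hB hBc hBi h0 h1 hA1 hB1 hK).antisymm ?_
  have := subset_vadd_of_brunnMinkowski_eq hB hBc hBi hA hAc hAi (l := 1 - l) (by linarith)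
    (by linarith) hB1 hA1 (by rwa [sub_sub_cancel, add_comm (l • B)])
  rw [← neg_sub] at this
  rintro _ ⟨p, hp, rfl⟩
  obtain ⟨q, hq, rfl⟩ := this hp
  change _ + (-_ + q) ∈ B
  rwa [add_neg_cancel_left]

end Equality

theorem measureReal_smul_euclideanSpace {d : ℕ} {c : ℝ} (hc : 0 ≤ c)
    (A : Set (EuclideanSpace ℝ (Fin d))) : volume.real (c • A) = c ^ d * volume.real A := by
  rw [measureReal_def, Measure.addHaar_smul_of_nonneg _ hc, finrank_euclideanSpace_fin,
    ENNReal.toReal_mul, ENNReal.toReal_ofReal (by positivity), measureReal_def]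

/-- A convex body of positive volume, rescaled to have volume one. -/
theorem exists_smul_measureReal_eq_one {n : ℕ} {A : Set (EuclideanSpace ℝ (Fin (n + 1)))}
    (hA : IsCompact A) (hAc : Convex ℝ A) (hAi : (interior A).Nonempty) :
    ∃ A' : Set (EuclideanSpace ℝ (Fin (n + 1))), ∃ a : ℝ, 0 < a ∧ A = a • A' ∧
      volume.real A ^ (1 / ((n + 1 : ℕ) : ℝ)) = a ∧ volume.real A' = 1 ∧ IsCompact A' ∧
      Convex ℝ A' ∧ (interior A').Nonempty := by
  have hM : 0 < volume.real A :=
    ENNReal.toReal_pos (Measure.measure_pos_of_nonempty_interior _ hAi).ne' hA.measure_lt_top.ne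
  set a := volume.real A ^ (1 / ((n + 1 : ℕ) : ℝ)) with ha
  have ha0 : 0 < a := by positivity
  have hpow : a ^ (n + 1) = volume.real A := by
    rw [ha, one_div, Real.rpow_inv_natCast_pow hM.le n.succ_ne_zero]
  refine ⟨a⁻¹ • A, a, ha0, (smul_inv_smul₀ ha0.ne' A).symm, rfl, ?_, hA.smul _, hAc.smul _, ?_⟩
  · rw [measureReal_smul_euclideanSpace (by positivity), inv_pow, hpow, inv_mul_cancel₀ hM.ne']
  · rw [interior_smul₀ (inv_ne_zero ha0.ne')]
    exact hAi.smul_set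


/-- Equality case of the Brunn–Minkowski inequality: equality holds iff
the convex bodies `A` and `B` are homothetic. -/
theorem brunn_minkowski_equality (d : ℕ)
    (A B : Set (EuclideanSpace ℝ (Fin d)))
    (hAc : IsCompact A) (hAcv : Convex ℝ A) (hAi : (interior A).Nonempty)
    (hBc : IsCompact B) (hBcv : Convex ℝ B) (hBi : (interior B).Nonempty)
    (α β : ℝ) (hα : 0 < α) (hβ : 0 < β) :
    (volume (α • A + β • B)).toReal =
      (α * (volume A).toReal ^ (1 / (d : ℝ)) +
        β * (volume B).toReal ^ (1 / (d : ℝ))) ^ d ↔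
      ∃ r : ℝ, 0 < r ∧ ∃ x : EuclideanSpace ℝ (Fin d), B = x +ᵥ r • A := by
  change volume.real (α • A + β • B) = (α * volume.real A ^ (1 / (d : ℝ)) +
    β * volume.real B ^ (1 / (d : ℝ))) ^ d ↔ _
  constructor
  · intro h
    cases d with
    | zero =>
      refine ⟨1, one_pos, 0, ?_⟩
      rw [Subsingleton.eq_univ_of_nonempty (hAi.mono interior_subset),
        Subsingleton.eq_univ_of_nonempty (hBi.mono interior_subset)]
      simp
    | succ n =>
      obtain ⟨A', a, ha, rfl, hAa, hA1, hA'⟩ := exists_smul_measureReal_eq_one hAc hAcv hAi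
      obtain ⟨B', b, hb, rfl, hBb, hB1, hB'⟩ := exists_smul_measureReal_eq_one hBc hBcv hBi
      rw [hAa, hBb] at h
      set σ := α * a + β * b with hσ
      have hσ0 : 0 < σ := by positivity
      have hl : 1 - β * b / σ = α * a / σ := by
        field_simp
        linarith
      have hK : volume.real ((1 - β * b / σ) • A' + (β * b / σ) • B') ≤ 1 := by
        have e : α • a • A' + β • b • B' = σ • ((1 - β * b / σ) • A' + (β * b / σ) • B') := by
          rw [hl, smul_add, smul_smul, smul_smul, smul_smul, smul_smul,
            mul_div_cancel₀ _ hσ0.ne', mul_div_cancel₀ _ hσ0.ne']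
        rw [e, measureReal_smul_euclideanSpace hσ0.le] at h
        exact (mul_eq_left₀ (pow_pos hσ0 _).ne').1 h |>.le
      have key := eq_vadd_of_brunnMinkowski_eq hA'.1 hA'.2.1 hA'.2.2 hB'.1 hB'.2.1 hB'.2.2
        (l := β * b / σ) (by positivity) (by rw [← sub_pos, hl]; positivity) hA1 hB1 hK
      set x := (∫ p in B', p) - ∫ p in A', p
      refine ⟨b / a, by positivity, b • x, ?_⟩
      rw [key, smul_smul, div_mul_cancel₀ _ ha.ne']
      ext y
      simp [mem_vadd_set, mem_smul_set]
  · rintro ⟨r, hr, x, rfl⟩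
    have e : α • A + β • (x +ᵥ r • A) = β • x +ᵥ (α + β * r) • A := by
      rw [hAcv.add_smul hα.le (by positivity), ← smul_smul, ← singleton_vadd, ← singleton_vadd,
        vadd_eq_add, vadd_eq_add, smul_add, smul_set_singleton, add_left_comm]
    have hvadd : ∀ (y : EuclideanSpace ℝ (Fin d)) (C : Set (EuclideanSpace ℝ (Fin d))),
        volume.real (y +ᵥ C) = volume.real C :=
      fun y C => by
      rw [measureReal_def, ← image_vadd]
      simp [measureReal_def]
    rw [e, hvadd, hvadd, measureReal_smul_euclideanSpace (by positivity),
      measureReal_smul_euclideanSpace hr.le]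
    rcases eq_or_ne d 0 with rfl | hd
    · rw [Subsingleton.eq_univ_of_nonempty (hAi.mono interior_subset), measureReal_def,
        volume_euclideanSpace_eq_dirac]
      simp
    rw [Real.mul_rpow (by positivity) measureReal_nonneg, one_div,
      Real.pow_rpow_inv_natCast hr.le hd, ← mul_assoc, ← add_mul, mul_pow,
      Real.rpow_inv_natCast_pow measureReal_nonneg hd]
end

section
/- Let A and B be convex bodies in R^d, u a unit vector, M = μ_{d-1}(π_u A) and N = μ_{d-1}(π_u B), where π_u denotes orthogonal projection onto the hyperplane u^⊥. Then for all α, β > 0: μ_d(αA + βB) ≥ (α M^{1/(d-1)} + β N^{1/(d-1)})^{d-1} · (α μ_d(A)/M + β μ_d(B)/N). -/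
open MeasureTheory Pointwise
open scoped RealInnerProductSpace

/-- The one-dimensional Brunn–Minkowski inequality for measurable sets. -/
theorem Real.volume_add_volume_le_of_add_subset {S T U : Set ℝ} (hS : MeasurableSet S)
    (hT : MeasurableSet T) (hS0 : S.Nonempty) (hT0 : T.Nonempty) (h : S + T ⊆ U) :
    volume S + volume T ≤ volume U := by
  have key : ∀ K L : Set ℝ, IsCompact K → IsCompact L → K.Nonempty → L.Nonempty → K ⊆ S → L ⊆ T →
      volume K + volume L ≤ volume U := by
    intro K L hK hL hK0 hL0 hKS hLT
    obtain ⟨a, ha, ha'⟩ := hK.exists_isGreatest hK0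
    obtain ⟨b, hb, hb'⟩ := hL.exists_isLeast hL0
    have hsub : (b +ᵥ K) ∪ (a +ᵥ L) ⊆ U := by
      rintro _ (⟨x, hx, rfl⟩ | ⟨x, hx, rfl⟩)
      · exact h ⟨x, hKS hx, b, hLT hb, add_comm _ _⟩
      · exact h ⟨a, hKS ha, x, hLT hx, rfl⟩
    have hdis : AEDisjoint volume (b +ᵥ K) (a +ᵥ L) := by
      refine measure_mono_null (t := {a + b}) ?_ (by simp)
      rintro _ ⟨⟨x, hx, rfl⟩, ⟨y, hy, hxy⟩⟩
      have h1 := ha' hx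
      have h2 := hb' hy
      simp only [vadd_eq_add, Set.mem_singleton_iff] at hxy ⊢
      linarith
    calc volume K + volume L = volume (b +ᵥ K) + volume (a +ᵥ L) := by
          rw [measure_vadd, measure_vadd]
      _ = volume ((b +ᵥ K) ∪ (a +ᵥ L)) :=
          (measure_union₀ (hL.vadd a).measurableSet.nullMeasurableSet hdis).symm
      _ ≤ volume U := measure_mono hsub
  obtain ⟨s, hs⟩ := hS0
  obtain ⟨t, ht⟩ := hT0
  rw [hS.measure_eq_iSup_isCompact, hT.measure_eq_iSup_isCompact]
  simp_rw [iSup_and']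
  refine ENNReal.biSup_add_biSup_le' ⟨∅, Set.empty_subset _, isCompact_empty⟩
    ⟨∅, Set.empty_subset _, isCompact_empty⟩ fun K hK L hL ↦ ?_
  calc volume K + volume L ≤ volume (insert s K) + volume (insert t L) :=
        add_le_add (measure_mono (Set.subset_insert _ _)) (measure_mono (Set.subset_insert _ _))
    _ ≤ volume U := key _ _ (hK.2.insert s) (hL.2.insert t) (Set.insert_nonempty _ _)
        (Set.insert_nonempty _ _) (Set.insert_subset hs hK.1) (Set.insert_subset ht hL.1)

/-- The Brunn–Minkowski inequality for compact sets in `ℝⁿ`, as a property of `n`. -/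
def BrunnMinkowski (n : ℕ) : Prop :=
  ∀ K L : Set (Fin n → ℝ), IsCompact K → IsCompact L → K.Nonempty → L.Nonempty →
    ((volume K).toReal ^ (1 / (n : ℝ)) + (volume L).toReal ^ (1 / (n : ℝ))) ^ n ≤
      (volume (K + L)).toReal

theorem mul_rpow_add_rpow_pow {n : ℕ} (hn : n ≠ 0) {p a b : ℝ} (hp : 0 ≤ p) (ha : 0 ≤ a)
    (hb : 0 ≤ b) :
    ((p * a) ^ (1 / (n : ℝ)) + (p * b) ^ (1 / (n : ℝ))) ^ n =
      p * (a ^ (1 / (n : ℝ)) + b ^ (1 / (n : ℝ))) ^ n := by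
  rw [Real.mul_rpow hp ha, Real.mul_rpow hp hb, ← mul_add, mul_pow, one_div,
    Real.rpow_inv_natCast_pow hp hn]

theorem BrunnMinkowski.le_of_add_subset {n : ℕ} (hn : n ≠ 0) (hBM : BrunnMinkowski n)
    {P Q R : Set (Fin n → ℝ)} (hP : MeasurableSet P) (hQ : MeasurableSet Q)
    (hPf : volume P ≠ ⊤) (hQf : volume Q ≠ ⊤) (hRf : volume R ≠ ⊤)
    (h : P + Q ⊆ R) {M N p : ℝ} (hM : 0 < M) (hN : 0 < N)
    (hMP : p * M ≤ (volume P).toReal) (hNQ : p * N ≤ (volume Q).toReal) :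
    p * (M ^ (1 / (n : ℝ)) + N ^ (1 / (n : ℝ))) ^ n ≤ (volume R).toReal := by
  have hC : 0 < (M ^ (1 / (n : ℝ)) + N ^ (1 / (n : ℝ))) ^ n := by positivity
  rw [← le_div_iff₀ hC]
  refine le_of_forall_lt_imp_le_of_dense fun q hq ↦ ?_
  rw [le_div_iff₀ hC]
  rcases le_or_gt q 0 with hq0 | hq0
  · exact (mul_nonpos_of_nonpos_of_nonneg hq0 hC.le).trans ENNReal.toReal_nonneg
  have aux : ∀ {S : Set (Fin n → ℝ)} {m : ℝ}, MeasurableSet S → volume S ≠ ⊤ → 0 < m →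
      p * m ≤ (volume S).toReal →
      ∃ K ⊆ S, IsCompact K ∧ K.Nonempty ∧ q * m ≤ (volume K).toReal := by
    intro S m hS hSf hm hmS
    have hlt : ENNReal.ofReal (q * m) < volume S := by
      rw [ENNReal.ofReal_lt_iff_lt_toReal (by positivity) hSf]
      exact (mul_lt_mul_of_pos_right hq hm).trans_le hmS
    obtain ⟨K, hKS, hK, hlt'⟩ := hS.exists_lt_isCompact hlt
    refine ⟨K, hKS, hK, ?_, ?_⟩
    · exact nonempty_of_measure_ne_zero (bot_le.trans_lt hlt').ne'
    · exact ((ENNReal.ofReal_lt_iff_lt_toReal (by positivity) hK.measure_ne_top).1 hlt').le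
  obtain ⟨K, hKP, hK, hK0, hKM⟩ := aux hP hPf hM hMP
  obtain ⟨L, hLQ, hL, hL0, hLN⟩ := aux hQ hQf hN hNQ
  rw [← mul_rpow_add_rpow_pow hn hq0.le hM.le hN.le]
  calc _ ≤ ((volume K).toReal ^ (1 / (n : ℝ)) + (volume L).toReal ^ (1 / (n : ℝ))) ^ n := by
        gcongr
    _ ≤ (volume (K + L)).toReal := hBM K L hK hL hK0 hL0
    _ ≤ (volume R).toReal :=
        ENNReal.toReal_mono hRf (measure_mono ((Set.add_subset_add hKP hLQ).trans h))

section Product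

variable {n : ℕ}

/-- The length of the fibre over `x` of a subset of `ℝ × ℝⁿ`. -/
noncomputable def fibreLength (A : Set (ℝ × (Fin n → ℝ))) (x : Fin n → ℝ) : ℝ :=
  (volume ((fun t : ℝ ↦ (t, x)) ⁻¹' A)).toReal

/-- The points of the projection of `A` over which the fibre of `A` has length at least `t`. -/
def fibreLevel (A : Set (ℝ × (Fin n → ℝ))) (t : ℝ) : Set (Fin n → ℝ) :=
  {x ∈ Prod.snd '' A | t ≤ fibreLength A x}

theorem isCompact_fibre {A : Set (ℝ × (Fin n → ℝ))} (hA : IsCompact A) (x : Fin n → ℝ) :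
    IsCompact ((fun t : ℝ ↦ (t, x)) ⁻¹' A) := by
  refine (hA.image continuous_fst).of_isClosed_subset
    (hA.isClosed.preimage (by fun_prop)) fun t ht ↦ ⟨(t, x), ht, rfl⟩

theorem measurable_fibreLength {A : Set (ℝ × (Fin n → ℝ))} (hA : IsCompact A) :
    Measurable (fibreLength A) :=
  (measurable_measure_prodMk_right hA.measurableSet).ennreal_toReal

theorem measurableSet_fibreLevel {A : Set (ℝ × (Fin n → ℝ))} (hA : IsCompact A) (t : ℝ) :
    MeasurableSet (fibreLevel A t) :=
  (hA.image continuous_snd).measurableSet.inter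
    (measurableSet_le measurable_const (measurable_fibreLength hA))

theorem volume_fibreLevel_ne_top {A : Set (ℝ × (Fin n → ℝ))} (hA : IsCompact A) (t : ℝ) :
    volume (fibreLevel A t) ≠ ⊤ :=
  measure_ne_top_of_subset (Set.sep_subset _ _) (hA.image continuous_snd).measure_ne_top

theorem antitone_volume_fibreLevel {A : Set (ℝ × (Fin n → ℝ))} (hA : IsCompact A) :
    Antitone fun t ↦ (volume (fibreLevel A t)).toReal := fun s _ hst ↦
  ENNReal.toReal_mono (volume_fibreLevel_ne_top hA s)
    (measure_mono fun _ hx ↦ ⟨hx.1, hst.trans hx.2⟩)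

theorem fibreLevel_of_nonpos (A : Set (ℝ × (Fin n → ℝ))) {t : ℝ} (ht : t ≤ 0) :
    fibreLevel A t = Prod.snd '' A := by
  ext x
  exact ⟨fun h ↦ h.1, fun h ↦ ⟨h, ht.trans ENNReal.toReal_nonneg⟩⟩

theorem lintegral_volume_fibreLevel {A : Set (ℝ × (Fin n → ℝ))} (hA : IsCompact A) :
    volume A = ∫⁻ t in Set.Ioi 0, ENNReal.ofReal (volume (fibreLevel A t)).toReal := by
  have h1 : volume A = ∫⁻ x, ENNReal.ofReal (fibreLength A x) := by
    rw [Measure.volume_eq_prod, Measure.prod_apply_symm hA.measurableSet]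
    refine lintegral_congr fun x ↦ ?_
    rw [fibreLength, ENNReal.ofReal_toReal (isCompact_fibre hA x).measure_ne_top]
  rw [h1, lintegral_eq_lintegral_meas_le (f := fibreLength A) _
    (.of_forall fun x ↦ ENNReal.toReal_nonneg) (measurable_fibreLength hA).aemeasurable]
  refine setLIntegral_congr_fun measurableSet_Ioi fun t ht ↦ ?_
  rw [ENNReal.ofReal_toReal (volume_fibreLevel_ne_top hA t)]
  congr 1
  ext x
  refine ⟨fun hx ↦ ⟨?_, hx⟩, fun hx ↦ hx.2⟩
  have : volume ((fun t : ℝ ↦ (t, x)) ⁻¹' A) ≠ 0 := fun h0 ↦ by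
    have h2 : t ≤ fibreLength A x := hx
    rw [fibreLength, h0, ENNReal.toReal_zero] at h2
    exact absurd h2 (not_le.2 ht)
  obtain ⟨s, hs⟩ := nonempty_of_measure_ne_zero this
  exact ⟨(s, x), hs, rfl⟩

theorem ofReal_volume_div_eq_lintegral {A : Set (ℝ × (Fin n → ℝ))} (hA : IsCompact A) {c : ℝ}
    (hc : 0 < c) :
    ENNReal.ofReal ((volume A).toReal / c) = ∫⁻ p in Set.Ioi 0,
      volume {t : ℝ | 0 ≤ t ∧ p ≤ (volume (fibreLevel A t)).toReal / c} := by
  have hm := (antitone_volume_fibreLevel hA).measurable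
  have h1 := lintegral_eq_lintegral_meas_le (volume.restrict (Set.Ioi (0 : ℝ)))
    (f := fun t ↦ (volume (fibreLevel A t)).toReal / c)
    (.of_forall fun t ↦ div_nonneg ENNReal.toReal_nonneg hc.le) (hm.div_const c).aemeasurable
  have h2 : ENNReal.ofReal ((volume A).toReal / c) = ∫⁻ t in Set.Ioi (0 : ℝ),
      ENNReal.ofReal ((volume (fibreLevel A t)).toReal / c) := by
    simp_rw [ENNReal.ofReal_div_of_pos hc, div_eq_mul_inv]
    rw [lintegral_mul_const _ hm.ennreal_ofReal, ← lintegral_volume_fibreLevel hA,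
      ENNReal.ofReal_toReal hA.measure_ne_top]
  rw [h2, h1]
  refine lintegral_congr fun p ↦ ?_
  rw [restrict_Ioi_eq_restrict_Ici,
    Measure.restrict_apply (measurableSet_le measurable_const (hm.div_const c))]
  congr 1
  ext t
  exact and_comm

theorem fibreLevel_add_subset {A B : Set (ℝ × (Fin n → ℝ))} (hA : IsCompact A)
    (hB : IsCompact B) (s t : ℝ) :
    fibreLevel A s + fibreLevel B t ⊆ fibreLevel (A + B) (s + t) := by
  rintro _ ⟨x, ⟨⟨a, ha, rfl⟩, hs⟩, y, ⟨⟨b, hb, rfl⟩, ht⟩, rfl⟩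
  refine ⟨⟨a + b, Set.add_mem_add ha hb, rfl⟩, (add_le_add hs ht).trans ?_⟩
  have hfA := isCompact_fibre hA a.2
  have hfB := isCompact_fibre hB b.2
  rw [fibreLength, fibreLength, ← ENNReal.toReal_add hfA.measure_ne_top hfB.measure_ne_top]
  refine ENNReal.toReal_mono (isCompact_fibre (hA.add hB) _).measure_ne_top ?_
  refine Real.volume_add_volume_le_of_add_subset hfA.measurableSet hfB.measurableSet
    ⟨a.1, ha⟩ ⟨b.1, hb⟩ ?_
  rintro _ ⟨p, hp, q, hq, rfl⟩
  exact ⟨_, hp, _, hq, rfl⟩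

end Product

theorem BrunnMinkowski.bonnesen_prod {n : ℕ} (hn : n ≠ 0) (hBM : BrunnMinkowski n)
    {A B : Set (ℝ × (Fin n → ℝ))} (hA : IsCompact A) (hB : IsCompact B) {M N : ℝ}
    (hM : M = (volume (Prod.snd '' A)).toReal) (hN : N = (volume (Prod.snd '' B)).toReal)
    (hM0 : 0 < M) (hN0 : 0 < N) :
    (M ^ (1 / (n : ℝ)) + N ^ (1 / (n : ℝ))) ^ n *
      ((volume A).toReal / M + (volume B).toReal / N) ≤ (volume (A + B)).toReal := by
  set C := (M ^ (1 / (n : ℝ)) + N ^ (1 / (n : ℝ))) ^ n with hC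
  have hC0 : 0 < C := by positivity
  rw [mul_comm, ← le_div_iff₀ hC0, ← ENNReal.ofReal_le_ofReal_iff (by positivity),
    ENNReal.ofReal_add (by positivity) (by positivity), ofReal_volume_div_eq_lintegral hA hM0,
    ofReal_volume_div_eq_lintegral hB hN0, ofReal_volume_div_eq_lintegral (hA.add hB) hC0]
  refine (le_lintegral_add _ _).trans (setLIntegral_mono' measurableSet_Ioi fun p hp ↦ ?_)
  have empty : ∀ {D : Set (ℝ × (Fin n → ℝ))} {c : ℝ}, IsCompact D → 0 < c →
      c = (volume (Prod.snd '' D)).toReal → 1 < p →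
      volume {t : ℝ | 0 ≤ t ∧ p ≤ (volume (fibreLevel D t)).toReal / c} = 0 := by
    intro D c hD hc hcD hp1
    convert measure_empty (μ := volume)
    refine Set.eq_empty_of_forall_notMem fun t ht ↦ ?_
    have h1 := antitone_volume_fibreLevel hD ht.1
    simp only [fibreLevel_of_nonpos D le_rfl, ← hcD] at h1
    have h2 := (div_le_one hc).2 h1
    linarith [ht.2]
  have nonempty : ∀ {D : Set (ℝ × (Fin n → ℝ))} {c : ℝ}, 0 < c →
      c = (volume (Prod.snd '' D)).toReal → p ≤ 1 →
      {t : ℝ | 0 ≤ t ∧ p ≤ (volume (fibreLevel D t)).toReal / c}.Nonempty := by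
    intro D c hc hcD hp1
    refine ⟨0, le_rfl, ?_⟩
    rwa [fibreLevel_of_nonpos D le_rfl, ← hcD, div_self hc.ne']
  have meas : ∀ {D : Set (ℝ × (Fin n → ℝ))} {c : ℝ}, IsCompact D →
      MeasurableSet {t : ℝ | 0 ≤ t ∧ p ≤ (volume (fibreLevel D t)).toReal / c} := by
    intro D c hD
    exact measurableSet_Ici.inter (measurableSet_le measurable_const
      ((antitone_volume_fibreLevel hD).measurable.div_const c))
  rcases lt_or_ge 1 p with hp1 | hp1
  · rw [empty hA hM0 hM hp1, empty hB hN0 hN hp1, zero_add]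
    exact zero_le
  refine Real.volume_add_volume_le_of_add_subset (meas hA) (meas hB) (nonempty hM0 hM hp1)
    (nonempty hN0 hN hp1) ?_
  rintro _ ⟨s, ⟨hs0, hs⟩, t, ⟨ht0, ht⟩, rfl⟩
  refine ⟨add_nonneg hs0 ht0, ?_⟩
  rw [le_div_iff₀ hM0] at hs
  rw [le_div_iff₀ hN0] at ht
  rw [le_div_iff₀ hC0]
  exact hBM.le_of_add_subset hn (measurableSet_fibreLevel hA s) (measurableSet_fibreLevel hB t)
    (volume_fibreLevel_ne_top hA s) (volume_fibreLevel_ne_top hB t)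
    (volume_fibreLevel_ne_top (hA.add hB) _)
    (fibreLevel_add_subset hA hB s t) hM0 hN0 hs ht

theorem volume_image_eq_of_injective {X Y : Type*} [TopologicalSpace X] [TopologicalSpace Y]
    [T2Space Y] [MeasureSpace X] [MeasureSpace Y] [OpensMeasurableSpace Y] {e : X → Y}
    (he : MeasurePreserving e) (hc : Continuous e) (hi : Function.Injective e) {A : Set X}
    (hA : IsCompact A) : volume (e '' A) = volume A := by
  rw [← he.measure_preimage (hA.image hc).measurableSet.nullMeasurableSet,
    Set.preimage_image_eq _ hi]

section Transfer

variable {E : Type*} [AddCommGroup E] [Module ℝ E] [TopologicalSpace E]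
  [MeasureSpace E] {n : ℕ}

theorem volume_pos_of_volume_snd_image_pos {e : E →ₗ[ℝ] ℝ × (Fin n → ℝ)}
    (he : MeasurePreserving e) (hc : Continuous e) (hi : Function.Injective e) {A : Set E}
    (hA : IsCompact A) (hA0 : volume A ≠ 0) : 0 < (volume (Prod.snd '' (e '' A))).toReal := by
  refine ENNReal.toReal_pos (fun h0 ↦ hA0 ?_)
    ((hA.image hc).image continuous_snd).measure_ne_top
  rw [← volume_image_eq_of_injective he hc hi hA]
  refine measure_mono_null (t := Set.univ ×ˢ (Prod.snd '' (e '' A)))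
    (fun x hx ↦ ⟨trivial, x, hx, rfl⟩) ?_
  rw [Measure.volume_eq_prod, Measure.prod_prod, h0, mul_zero]

theorem BrunnMinkowski.bonnesen [ContinuousAdd E] (hn : n ≠ 0) (hBM : BrunnMinkowski n)
    {e : E →ₗ[ℝ] ℝ × (Fin n → ℝ)} (he : MeasurePreserving e) (hc : Continuous e)
    (hi : Function.Injective e) {A B : Set E} (hA : IsCompact A) (hB : IsCompact B)
    (hA0 : volume A ≠ 0) (hB0 : volume B ≠ 0) {M N : ℝ}
    (hM : M = (volume (Prod.snd '' (e '' A))).toReal)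
    (hN : N = (volume (Prod.snd '' (e '' B))).toReal) :
    (M ^ (1 / (n : ℝ)) + N ^ (1 / (n : ℝ))) ^ n *
      ((volume A).toReal / M + (volume B).toReal / N) ≤ (volume (A + B)).toReal := by
  have h := hBM.bonnesen_prod hn (hA.image hc) (hB.image hc) hM hN
    (hM ▸ volume_pos_of_volume_snd_image_pos he hc hi hA hA0)
    (hN ▸ volume_pos_of_volume_snd_image_pos he hc hi hB hB0)
  rwa [← Set.image_add, volume_image_eq_of_injective he hc hi hA,
    volume_image_eq_of_injective he hc hi hB,
    volume_image_eq_of_injective he hc hi (hA.add hB)] at h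

end Transfer

theorem add_pow_succ_le_mul_div_add_div {v w a b : ℝ} (hv : 0 ≤ v) (hw : 0 ≤ w) (ha : 0 < a)
    (hb : 0 < b) (n : ℕ) :
    (v + w) ^ (n + 1) ≤ (a + b) ^ n * (v ^ (n + 1) / a ^ n + w ^ (n + 1) / b ^ n) := by
  have h := (convexOn_pow (𝕜 := ℝ) (n + 1)).2
    (Set.mem_Ici.2 (by positivity : 0 ≤ v / a)) (Set.mem_Ici.2 (by positivity : 0 ≤ w / b))
    (by positivity : 0 ≤ a / (a + b)) (by positivity : 0 ≤ b / (a + b)) (by field_simp)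
  simp only [smul_eq_mul] at h
  calc (v + w) ^ (n + 1)
      = (a + b) ^ (n + 1) * (a / (a + b) * (v / a) + b / (a + b) * (w / b)) ^ (n + 1) := by
        rw [← mul_pow]
        congr 1
        field_simp
    _ ≤ (a + b) ^ (n + 1) *
        (a / (a + b) * (v / a) ^ (n + 1) + b / (a + b) * (w / b) ^ (n + 1)) := by gcongr
    _ = _ := by
        rw [div_pow, div_pow]
        field_simp
        ring

/-- The coordinate splitting `ℝⁿ⁺¹ → ℝ × ℝⁿ`. -/
def splitFirst (n : ℕ) : (Fin (n + 1) → ℝ) →ₗ[ℝ] ℝ × (Fin n → ℝ) where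
  toFun x := (x 0, fun i ↦ x i.succ)
  map_add' _ _ := rfl
  map_smul' _ _ := rfl

theorem measurePreserving_splitFirst (n : ℕ) : MeasurePreserving (splitFirst n) :=
  volume_preserving_piFinSuccAbove (fun _ : Fin (n + 1) ↦ ℝ) 0

theorem continuous_splitFirst (n : ℕ) : Continuous (splitFirst n) := by
  change Continuous fun x : Fin (n + 1) → ℝ ↦ (x 0, fun i : Fin n ↦ x i.succ)
  fun_prop

theorem injective_splitFirst (n : ℕ) : Function.Injective (splitFirst n) := by
  intro x y h
  ext i
  refine Fin.cases (congrArg Prod.fst h) (fun j ↦ congrFun (congrArg Prod.snd h) j) i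

theorem brunnMinkowski_one : BrunnMinkowski 1 := by
  intro K L hK hL hK0 hL0
  have hc : Continuous (MeasurableEquiv.funUnique (Fin 1) ℝ) := continuous_apply _
  have hvol : ∀ {A : Set (Fin 1 → ℝ)}, IsCompact A →
      volume ((MeasurableEquiv.funUnique (Fin 1) ℝ) '' A) = volume A := fun hA ↦
    volume_image_eq_of_injective (volume_preserving_funUnique (Fin 1) ℝ) hc
      (MeasurableEquiv.injective _) hA
  simp only [Nat.cast_one, div_one, Real.rpow_one, pow_one]
  rw [← ENNReal.toReal_add hK.measure_ne_top hL.measure_ne_top]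
  refine ENNReal.toReal_mono (hK.add hL).measure_ne_top ?_
  rw [← hvol hK, ← hvol hL, ← hvol (hK.add hL)]
  refine Real.volume_add_volume_le_of_add_subset (hK.image hc).measurableSet
    (hL.image hc).measurableSet (hK0.image _) (hL0.image _) ?_
  rintro _ ⟨_, ⟨x, hx, rfl⟩, _, ⟨y, hy, rfl⟩, rfl⟩
  exact ⟨x + y, Set.add_mem_add hx hy, rfl⟩

theorem BrunnMinkowski.succ {n : ℕ} (hn : n ≠ 0) (hBM : BrunnMinkowski n) :
    BrunnMinkowski (n + 1) := by
  intro K L hK hL hK0 hL0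
  have hKL := (hK.add hL).measure_ne_top (μ := volume)
  have hroot : ∀ {t : ℝ}, 0 ≤ t → (t ^ (1 / ((n + 1 : ℕ) : ℝ))) ^ (n + 1) = t := fun ht ↦ by
    rw [one_div, Real.rpow_inv_natCast_pow ht n.succ_ne_zero]
  have hne : 1 / ((n + 1 : ℕ) : ℝ) ≠ 0 := by positivity
  by_cases hK1 : volume K = 0
  · obtain ⟨x, hx⟩ := hK0
    rw [hK1, ENNReal.toReal_zero, Real.zero_rpow hne, zero_add, hroot ENNReal.toReal_nonneg]
    refine ENNReal.toReal_mono hKL ?_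
    rw [← measure_vadd volume x L]
    exact measure_mono (by rintro _ ⟨y, hy, rfl⟩; exact Set.add_mem_add hx hy)
  by_cases hL1 : volume L = 0
  · obtain ⟨x, hx⟩ := hL0
    rw [hL1, ENNReal.toReal_zero, Real.zero_rpow hne, add_zero, hroot ENNReal.toReal_nonneg]
    refine ENNReal.toReal_mono hKL ?_
    rw [← measure_vadd volume x K, add_comm K L]
    exact measure_mono (by rintro _ ⟨y, hy, rfl⟩; exact Set.add_mem_add hx hy)
  have he := measurePreserving_splitFirst n
  have hc := continuous_splitFirst n
  have hi := injective_splitFirst n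
  have hM := volume_pos_of_volume_snd_image_pos he hc hi hK hK1
  have hN := volume_pos_of_volume_snd_image_pos he hc hi hL hL1
  refine le_trans ?_ (hBM.bonnesen hn he hc hi hK hL hK1 hL1 rfl rfl)
  have h := add_pow_succ_le_mul_div_add_div
    (v := (volume K).toReal ^ (1 / ((n + 1 : ℕ) : ℝ)))
    (w := (volume L).toReal ^ (1 / ((n + 1 : ℕ) : ℝ))) (by positivity) (by positivity)
    (Real.rpow_pos_of_pos hM (1 / (n : ℝ))) (Real.rpow_pos_of_pos hN (1 / (n : ℝ))) n
  rw [hroot ENNReal.toReal_nonneg, hroot ENNReal.toReal_nonneg] at h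
  simpa only [one_div, Real.rpow_inv_natCast_pow ENNReal.toReal_nonneg hn] using h

theorem brunnMinkowski {n : ℕ} (hn : n ≠ 0) : BrunnMinkowski n := by
  induction n, Nat.one_le_iff_ne_zero.2 hn using Nat.le_induction with
  | base => exact brunnMinkowski_one
  | succ n hn' ih => exact (ih (by lia)).succ (by lia)

section Projection

variable {n : ℕ} (b : OrthonormalBasis (Fin (n + 1)) ℝ (EuclideanSpace ℝ (Fin (n + 1))))

/-- Coordinates in an orthonormal basis, with the first one split off. -/
noncomputable def splitBasis : EuclideanSpace ℝ (Fin (n + 1)) →ₗ[ℝ] ℝ × (Fin n → ℝ) :=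
  splitFirst n ∘ₗ (WithLp.linearEquiv 2 ℝ (Fin (n + 1) → ℝ)).toLinearMap ∘ₗ
    b.repr.toLinearEquiv.toLinearMap

theorem measurePreserving_splitBasis : MeasurePreserving (splitBasis b) :=
  ((measurePreserving_splitFirst n).comp (PiLp.volume_preserving_ofLp _)).comp
    b.measurePreserving_repr

theorem continuous_splitBasis : Continuous (splitBasis b) :=
  ((continuous_splitFirst n).comp (PiLp.continuous_ofLp 2 _)).comp b.repr.continuous

theorem injective_splitBasis : Function.Injective (splitBasis b) :=
  ((injective_splitFirst n).comp (WithLp.ofLp_injective 2)).comp b.repr.injective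

theorem snd_splitBasis_apply (x : EuclideanSpace ℝ (Fin (n + 1))) (i : Fin n) :
    (splitBasis b x).2 i = b.repr x i.succ := rfl

/-- The inclusion of the hyperplane orthogonal to the first vector of an orthonormal basis. -/
noncomputable def hyperplaneInclusion (y : EuclideanSpace ℝ (Fin n)) :
    EuclideanSpace ℝ (Fin (n + 1)) :=
  b.repr.symm (WithLp.toLp 2 (Fin.cons 0 (WithLp.ofLp y) : Fin (n + 1) → ℝ))

theorem isometry_hyperplaneInclusion : Isometry (hyperplaneInclusion b) := by
  refine b.repr.symm.isometry.comp (Isometry.of_dist_eq fun x y ↦ ?_)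
  simp [EuclideanSpace.dist_eq, Fin.sum_univ_succ]

theorem sub_inner_smul_eq_hyperplaneInclusion (x : EuclideanSpace ℝ (Fin (n + 1))) :
    x - ⟪x, b 0⟫ • b 0 = hyperplaneInclusion b (WithLp.toLp 2 (splitBasis b x).2) := by
  apply b.repr.injective
  rw [hyperplaneInclusion, LinearIsometryEquiv.apply_symm_apply]
  ext i
  refine Fin.cases ?_ (fun j ↦ ?_) i
  · simp [b.repr_apply_apply, real_inner_comm]
  · simp [b.repr_apply_apply, snd_splitBasis_apply]

theorem exists_hausdorffMeasure_projection_eq (n : ℕ) :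
    ∃ c : ℝ, 0 < c ∧ ∀ (b : OrthonormalBasis (Fin (n + 1)) ℝ (EuclideanSpace ℝ (Fin (n + 1))))
      (A : Set (EuclideanSpace ℝ (Fin (n + 1)))), IsCompact A →
      (μH[(n : ℝ)] ((fun x ↦ x - ⟪x, b 0⟫ • b 0) '' A)).toReal =
        c * (volume (Prod.snd '' (splitBasis b '' A))).toReal := by
  have : Measure.IsAddHaarMeasure (μH[(n : ℝ)] : Measure (EuclideanSpace ℝ (Fin n))) := by
    simpa using isAddHaarMeasure_hausdorffMeasure (E := EuclideanSpace ℝ (Fin n))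
  refine ⟨Measure.addHaarScalarFactor μH[(n : ℝ)] (volume : Measure (EuclideanSpace ℝ (Fin n))),
    mod_cast Measure.addHaarScalarFactor_pos_of_isAddHaarMeasure _ _, fun b A hA ↦ ?_⟩
  have himage : (fun x ↦ x - ⟪x, b 0⟫ • b 0) '' A =
      hyperplaneInclusion b '' (WithLp.toLp 2 '' (Prod.snd '' (splitBasis b '' A))) := by
    simp only [Set.image_image, sub_inner_smul_eq_hyperplaneInclusion]
  rw [himage, (isometry_hyperplaneInclusion b).hausdorffMeasure_image (.inl n.cast_nonneg)]
  conv_lhs => rw [Measure.isAddLeftInvariant_eq_smul μH[(n : ℝ)]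
    (volume : Measure (EuclideanSpace ℝ (Fin n)))]
  rw [Measure.smul_apply, volume_image_eq_of_injective (PiLp.volume_preserving_toLp _)
    (PiLp.continuous_toLp 2 _) (WithLp.toLp_injective 2)
    ((hA.image (continuous_splitBasis b)).image continuous_snd), ENNReal.smul_def, smul_eq_mul,
    ENNReal.toReal_mul, ENNReal.coe_toReal]

theorem volume_smul_toReal {r : ℝ} (hr : 0 < r) (A : Set (EuclideanSpace ℝ (Fin (n + 1)))) :
    (volume (r • A)).toReal = r ^ (n + 1) * (volume A).toReal := by
  rw [Measure.addHaar_smul_of_nonneg _ hr.le, ENNReal.toReal_mul,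
    ENNReal.toReal_ofReal (by positivity), finrank_euclideanSpace_fin]

theorem volume_snd_splitBasis_smul_toReal {r : ℝ} (hr : 0 < r)
    (A : Set (EuclideanSpace ℝ (Fin (n + 1)))) :
    (volume (Prod.snd '' (splitBasis b '' (r • A)))).toReal =
      r ^ n * (volume (Prod.snd '' (splitBasis b '' A))).toReal := by
  have h : Prod.snd '' (splitBasis b '' (r • A)) = r • Prod.snd '' (splitBasis b '' A) := by
    simp only [← Set.image_smul, Set.image_image, map_smul, Prod.smul_snd]
  rw [h, Measure.addHaar_smul_of_nonneg _ hr.le, ENNReal.toReal_mul,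
    ENNReal.toReal_ofReal (by positivity), Module.finrank_fin_fun]

end Projection

/-- Bonnesen's inequality for projections: `π_u` is the orthogonal projection
onto `u^⊥` and `M`, `N` are the `(d-1)`-volumes of the projections of `A`, `B`. -/
theorem bonnesen_projections (d : ℕ) (hd : 2 ≤ d)
    (u : EuclideanSpace ℝ (Fin d)) (hu : ‖u‖ = 1)
    (A B : Set (EuclideanSpace ℝ (Fin d)))
    (hAc : IsCompact A) (hAcv : Convex ℝ A) (hAi : (interior A).Nonempty)
    (hBc : IsCompact B) (hBcv : Convex ℝ B) (hBi : (interior B).Nonempty)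
    (M N : ℝ)
    (hM : M = (μH[(d : ℝ) - 1] ((fun x => x - ⟪x, u⟫ • u) '' A)).toReal)
    (hN : N = (μH[(d : ℝ) - 1] ((fun x => x - ⟪x, u⟫ • u) '' B)).toReal)
    (α β : ℝ) (hα : 0 < α) (hβ : 0 < β) :
    (volume (α • A + β • B)).toReal ≥
      (α * M ^ (1 / ((d : ℝ) - 1)) + β * N ^ (1 / ((d : ℝ) - 1))) ^ (d - 1) *
        (α * (volume A).toReal / M + β * (volume B).toReal / N) := by
  obtain ⟨n, rfl⟩ : ∃ n, d = n + 1 := ⟨d - 1, by lia⟩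
  have hn : n ≠ 0 := by lia
  obtain ⟨b, hb⟩ := Orthonormal.exists_orthonormalBasis_extension_of_card_eq (𝕜 := ℝ)
    (v := fun _ : Fin (n + 1) ↦ u) (s := {0}) (by simp)
    ⟨fun _ ↦ hu, fun i j hij ↦ absurd (Subsingleton.elim i j) hij⟩
  obtain rfl : b 0 = u := hb 0 rfl
  obtain ⟨c, hc, hproj⟩ := exists_hausdorffMeasure_projection_eq n
  have hcast : ((n + 1 : ℕ) : ℝ) - 1 = n := by simp
  rw [hcast, hproj b A hAc] at hM
  rw [hcast, hproj b B hBc] at hN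
  rw [hcast, Nat.add_sub_cancel]
  have he := measurePreserving_splitBasis b
  have hec := continuous_splitBasis b
  have hei := injective_splitBasis b
  have hA0 : volume A ≠ 0 := (Measure.measure_pos_of_nonempty_interior _ hAi).ne'
  have hB0 : volume B ≠ 0 := (Measure.measure_pos_of_nonempty_interior _ hBi).ne'
  have hm := volume_pos_of_volume_snd_image_pos he hec hei hAc hA0
  have hk := volume_pos_of_volume_snd_image_pos he hec hei hBc hB0
  have hscale : ∀ {r : ℝ} {D : Set (EuclideanSpace ℝ (Fin (n + 1)))}, 0 < r → volume D ≠ 0 →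
      volume (r • D) ≠ 0 := by
    intro r D hr hD
    rw [Measure.addHaar_smul_of_nonneg _ hr.le]
    exact mul_ne_zero (ENNReal.ofReal_pos.2 (by positivity)).ne' hD
  have key := (brunnMinkowski hn).bonnesen hn he hec hei (hAc.smul α) (hBc.smul β)
    (hscale hα hA0) (hscale hβ hB0) (volume_snd_splitBasis_smul_toReal b hα A).symm
    (volume_snd_splitBasis_smul_toReal b hβ B).symm
  refine le_of_eq_of_le ?_ key
  rw [volume_smul_toReal hα, volume_smul_toReal hβ, hM, hN]
  set m := (volume (Prod.snd '' (splitBasis b '' A))).toReal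
  set k := (volume (Prod.snd '' (splitBasis b '' B))).toReal
  have hroot : ∀ {r t : ℝ}, 0 < r → 0 < t →
      (r ^ n * t) ^ (1 / (n : ℝ)) = r * t ^ (1 / (n : ℝ)) := by
    intro r t hr ht
    rw [Real.mul_rpow (by positivity) ht.le, one_div, Real.pow_rpow_inv_natCast hr.le hn]
  rw [← hroot hα (mul_pos hc hm), ← hroot hβ (mul_pos hc hk), mul_left_comm, mul_left_comm (β ^ n),
    mul_rpow_add_rpow_pow hn hc.le (by positivity) (by positivity)]
  field_simp
  ring
end

section
/- Let l be a line through the origin in R^2 and C = αA + βB for convex bodies A, B in R^2 with α, β > 0, α + β = 1. Assume: (i) for every z ∈ C, the line z + l intersects A and B and C ∩ (z + l) = α(A ∩ (z + l)) + β(B ∩ (z + l)); and (ii) there exists z ∈ C with C ∩ (z + l) = A ∩ (z + l) = B ∩ (z + l). Then A = B. -/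
open MeasureTheory Pointwise

section Auxiliary

/-- Two convex functions with a common monotone selection of subgradients differ by a constant. -/
theorem sub_eq_sub_of_common_subgradient {φ ψ x : ℝ → ℝ}
    (hφ : ∀ s t, φ s + x s * (t - s) ≤ φ t) (hψ : ∀ s t, ψ s + x s * (t - s) ≤ ψ t)
    {s t : ℝ} (hst : s ≤ t) : φ t - ψ t = φ s - ψ s := by
  have bisect : ∀ (k : ℕ) (s t : ℝ), s ≤ t →
      |(φ t - ψ t) - (φ s - ψ s)| ≤ (x t - x s) * (t - s) * (1 / 2) ^ k := by
    intro k
    induction k with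
    | zero =>
      intro s t _
      have h1 := hφ s t
      have h2 := hφ t s
      have h3 := hψ s t
      have h4 := hψ t s
      rw [abs_le]
      constructor <;> linarith
    | succ k ih =>
      intro s t hst
      have h1 := ih s ((s + t) / 2) (by linarith)
      have h2 := ih ((s + t) / 2) t (by linarith)
      calc |(φ t - ψ t) - (φ s - ψ s)|
          ≤ |(φ t - ψ t) - (φ ((s + t) / 2) - ψ ((s + t) / 2))|
            + |(φ ((s + t) / 2) - ψ ((s + t) / 2)) - (φ s - ψ s)| := abs_sub_le _ _ _
        _ ≤ _ := add_le_add h2 h1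
        _ = _ := by ring
  have hlim : Filter.Tendsto (fun k : ℕ => (x t - x s) * (t - s) * (1 / 2 : ℝ) ^ k)
      Filter.atTop (nhds 0) := by
    simpa using (tendsto_pow_atTop_nhds_zero_of_lt_one (r := (1 / 2 : ℝ)) (by norm_num)
      (by norm_num)).const_mul ((x t - x s) * (t - s))
  have h0 := ge_of_tendsto' hlim fun k => bisect k s t hst
  linarith [abs_nonpos_iff.mp h0]

variable {E : Type*} [NormedAddCommGroup E] [NormedSpace ℝ E]

/-- A point dominated on a compact convex set `K` by every functional normalized on `w` lies
below `K` in the direction `w`. -/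
theorem exists_add_smul_mem_of_forall_dual_le {w : E} (hw : w ≠ 0) {K : Set E}
    (hK : IsCompact K) (hKc : Convex ℝ K) {p : E}
    (h : ∀ u : StrongDual ℝ E, u w = 1 → ∃ a ∈ K, u p ≤ u a) :
    ∃ t : ℝ, 0 ≤ t ∧ p + t • w ∈ K := by
  by_contra! hcon
  set R : Set E := (fun x => p + x) '' ((fun t : ℝ => t • w) '' Set.Ici 0) with hR
  have hRc : Convex ℝ R :=
    ((convex_Ici (0 : ℝ)).is_linear_image (IsLinearMap.isLinearMap_smul' w)).translate p
  have hRcl : IsClosed R :=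
    (Homeomorph.addLeft p).isClosedMap _ ((isClosedEmbedding_smul_left hw).isClosedMap _ isClosed_Ici)
  have hdisj : Disjoint K R := by
    rw [Set.disjoint_left]
    rintro _ hk ⟨_, ⟨t, ht, rfl⟩, rfl⟩
    exact hcon t ht hk
  obtain ⟨u, c, d, huc, hcd, hdu⟩ := geometric_hahn_banach_compact_closed hKc hK hRc hRcl hdisj
  have hray : ∀ t : ℝ, 0 ≤ t → d < u p + t * u w := fun t ht => by
    simpa using hdu _ ⟨_, ⟨t, ht, rfl⟩, rfl⟩
  have huw : 0 ≤ u w := by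
    by_contra! hneg
    have hp : 0 < u p - d := by simpa using hray 0 le_rfl
    have := hray ((u p - d) / (-u w)) (div_nonneg hp.le (by linarith))
    have e : (u p - d) / (-u w) * u w = -(u p - d) := by
      rw [div_neg, neg_mul, div_mul_cancel₀ _ hneg.ne]
    linarith
  obtain ⟨e, he⟩ := SeparatingDual.exists_eq_one (R := ℝ) hw
  obtain ⟨M, hM⟩ := (hK.image e.continuous).bddAbove
  set ε : ℝ := (d - c) / (|M| + |e p| + 1) with hε
  have hden : 0 < |M| + |e p| + 1 := by positivity
  have hε0 : 0 < ε := div_pos (by linarith) hden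
  have hεd : ε * (|M| + |e p| + 1) = d - c := by rw [hε]; field_simp
  have hv : 0 < u w + ε := by linarith
  obtain ⟨a, ha, hle⟩ := h ((u w + ε)⁻¹ • (u + ε • e)) (by
    simp only [smul_apply, add_apply, smul_eq_mul, he,
      mul_one]
    exact inv_mul_cancel₀ hv.ne')
  simp only [smul_apply, add_apply, smul_eq_mul] at hle
  have hle' := le_of_mul_le_mul_left hle (inv_pos.mpr hv)
  have h1 := huc a ha
  have h2 : d < u p := by simpa using hray 0 le_rfl
  have h3 : e a ≤ |M| := (hM ⟨a, ha, rfl⟩).trans (le_abs_self M)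
  have h4 := neg_abs_le (e p)
  nlinarith [mul_le_mul_of_nonneg_left h3 hε0.le, mul_le_mul_of_nonneg_left h4 hε0.le]

/-- Every functional normalized on `w` attains its maxima over `A` and over `B` at points of a
common line parallel to `w`. -/
def HasAlignedMaximizers (w : E) (A B : Set E) : Prop :=
  ∀ u : StrongDual ℝ E, u w = 1 →
    ∃ a ∈ A, ∃ b ∈ B, IsMaxOn u A a ∧ IsMaxOn u B b ∧ ∃ t : ℝ, a = b + t • w

theorem HasAlignedMaximizers.swap {w : E} {A B : Set E} (h : HasAlignedMaximizers w A B) :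
    HasAlignedMaximizers w B A := by
  intro u hu
  obtain ⟨a, ha, b, hb, hma, hmb, t, rfl⟩ := h u hu
  exact ⟨b, hb, _, ha, hmb, hma, -t, by module⟩

/-- The difference of the support functions is constant on normalized functionals. -/
theorem HasAlignedMaximizers.exists_const {w : E} (hw : w ≠ 0) {A B : Set E}
    (h : HasAlignedMaximizers w A B) :
    ∃ D : ℝ, ∀ u : StrongDual ℝ E, u w = 1 →
      ∃ a ∈ A, ∃ b ∈ B, IsMaxOn u A a ∧ IsMaxOn u B b ∧ u a = u b + D := by
  choose! a ha b hb hma hmb hab using h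
  obtain ⟨v, hv⟩ := SeparatingDual.exists_eq_one (R := ℝ) hw
  refine ⟨v (a v) - v (b v), fun u hu =>
    ⟨a u, ha u hu, b u, hb u hu, hma u hu, hmb u hu, ?_⟩⟩
  set n : StrongDual ℝ E := u - v with hn
  set f : ℝ → StrongDual ℝ E := fun s => v + s • n with hf
  have hnw : n w = 0 := by simp [hn, hu, hv]
  have hfw : ∀ s, f s w = 1 := fun s => by simp [hf, hnw, hv]
  have hshift : ∀ s t x, f t x = f s x + n x * (t - s) := fun s t x => by
    simp only [hf, add_apply, smul_apply, smul_eq_mul]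
    ring
  have hnab : ∀ s, n (a (f s)) = n (b (f s)) := fun s => by
    obtain ⟨t, ht⟩ := hab (f s) (hfw s)
    rw [ht]
    simp [hnw]
  have key := sub_eq_sub_of_common_subgradient (φ := fun s => f s (a (f s)))
    (ψ := fun s => f s (b (f s))) (x := fun s => n (a (f s)))
    (fun s t => by
      have := hma (f t) (hfw t) (ha (f s) (hfw s))
      rw [← hshift]
      exact this)
    (fun s t => by
      have := hmb (f t) (hfw t) (hb (f s) (hfw s))
      simp only [hnab]
      rw [← hshift]
      exact this) zero_le_one
  have hf0 : f 0 = v := by simp [hf]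
  have hf1 : f 1 = u := by simp [hf, hn]
  simp only [hf0, hf1] at key
  linarith

/-- With a common chord, the constant by which the support functions differ is nonpositive. -/
theorem nonpos_of_common_chord {w : E} (hw : w ≠ 0) {A B : Set E} (hA : IsCompact A)
    (hAc : Convex ℝ A) (hB : IsCompact B) {D : ℝ}
    (hD : ∀ u : StrongDual ℝ E, u w = 1 →
      ∃ a ∈ A, ∃ b ∈ B, IsMaxOn u A a ∧ IsMaxOn u B b ∧ u a = u b + D)
    {z : E} (hz : z ∈ B) (hzAB : ∀ t : ℝ, z + t • w ∈ A → z + t • w ∈ B) : D ≤ 0 := by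
  have hcl : IsClosed ((fun t : ℝ => z + t • w) ⁻¹' B) :=
    hB.isClosed.preimage (by fun_prop)
  obtain ⟨v, hv⟩ := SeparatingDual.exists_eq_one (R := ℝ) hw
  obtain ⟨M, hM⟩ := (hB.image v.continuous).bddAbove
  have hbdd : BddAbove ((fun t : ℝ => z + t • w) ⁻¹' B) := by
    refine ⟨M - v z, fun t ht => ?_⟩
    have := hM ⟨_, ht, rfl⟩
    simp only [map_add, map_smul, hv, smul_eq_mul, mul_one] at this
    linarith
  have hmem := hcl.csSup_mem ⟨0, by simpa using hz⟩ hbdd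
  set T := sSup ((fun t : ℝ => z + t • w) ⁻¹' B)
  obtain ⟨t, ht, hmemA⟩ := exists_add_smul_mem_of_forall_dual_le hw hA hAc
    (p := (z + T • w) + D • w) (fun u hu => by
      obtain ⟨a, ha, b, -, -, hmb, hab⟩ := hD u hu
      refine ⟨a, ha, ?_⟩
      have h1 : u (z + T • w) ≤ u b := hmb hmem
      rw [map_add _ _ (D • w), map_smul, hu, hab, smul_eq_mul, mul_one]
      linarith)
  have heq : z + T • w + D • w + t • w = z + (T + D + t) • w := by module
  rw [heq] at hmemA
  have := le_csSup hbdd (hzAB _ hmemA)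
  change T + D + t ≤ T at this
  linarith

theorem HasAlignedMaximizers.exists_add_smul_mem {w : E} (hw : w ≠ 0) {A B : Set E}
    (hA : IsCompact A) (hAc : Convex ℝ A) (hB : IsCompact B) (hBc : Convex ℝ B)
    (h : HasAlignedMaximizers w A B) {z : E} (hz : z ∈ B)
    (hzAB : ∀ t : ℝ, z + t • w ∈ A → z + t • w ∈ B) {p : E} (hp : p ∈ A) :
    ∃ t : ℝ, 0 ≤ t ∧ p + t • w ∈ B := by
  obtain ⟨D, hD⟩ := h.swap.exists_const hw
  have hD0 : -D ≤ 0 := nonpos_of_common_chord hw hA hAc hB (fun u hu => by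
    obtain ⟨b, hb, a, ha, hmb, hma, hab⟩ := hD u hu
    exact ⟨a, ha, b, hb, hma, hmb, by linarith⟩) hz hzAB
  refine exists_add_smul_mem_of_forall_dual_le hw hB hBc fun u hu => ?_
  obtain ⟨b, hb, a, -, -, hma, hab⟩ := hD u hu
  have h1 : u p ≤ u a := hma hp
  exact ⟨b, hb, by linarith⟩

theorem subset_of_hasAlignedMaximizers {w : E} (hw : w ≠ 0) {A B : Set E}
    (hA : IsCompact A) (hAc : Convex ℝ A) (hB : IsCompact B) (hBc : Convex ℝ B)
    (h : HasAlignedMaximizers w A B) (h' : HasAlignedMaximizers (-w) A B) {z : E} (hz : z ∈ B)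
    (hzAB : ∀ t : ℝ, z + t • w ∈ A → z + t • w ∈ B) : A ⊆ B := by
  intro p hp
  obtain ⟨t, ht, hpt⟩ := h.exists_add_smul_mem hw hA hAc hB hBc hz hzAB hp
  obtain ⟨s, hs, hps⟩ := h'.exists_add_smul_mem (neg_ne_zero.mpr hw) hA hAc hB hBc hz
    (fun r hr => by simpa using hzAB (-r) (by simpa using hr)) hp
  have hsub := hBc.segment_subset hps hpt
  rcases eq_or_lt_of_le ht with rfl | ht0
  · simpa using hpt
  have hst : 0 < s + t := by linarith
  refine hsub ⟨t / (s + t), s / (s + t), by positivity, by positivity, by field_simp; ring, ?_⟩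
  match_scalars <;> field_simp <;> ring

theorem mem_vadd_range_smul {z w x : E} :
    x ∈ z +ᵥ Set.range (fun t : ℝ => t • w) ↔ ∃ t : ℝ, x = z + t • w := by
  simp [Set.mem_vadd_set, eq_comm]

/-- If the chords of `α • A + β • B` parallel to `w` are contained in the combinations of the
corresponding chords, then maximizers over `A` and `B` can be chosen on a common chord. -/
theorem hasAlignedMaximizers_of_chords {w v : E} {A B : Set E} {α β : ℝ} (hα : 0 < α)
    (hβ : 0 < β) (hC : IsCompact (α • A + β • B)) (hne : (α • A + β • B).Nonempty)
    (hv : ∃ c : ℝ, w = c • v)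
    (hi : ∀ z ∈ α • A + β • B,
      (α • A + β • B) ∩ (z +ᵥ Set.range fun t : ℝ => t • w) ⊆
        α • (A ∩ (z +ᵥ Set.range fun t : ℝ => t • w)) +
          β • (B ∩ (z +ᵥ Set.range fun t : ℝ => t • w))) :
    HasAlignedMaximizers v A B := by
  intro u _
  obtain ⟨c, rfl⟩ := hv
  obtain ⟨z, hz, hmax⟩ := hC.exists_isMaxOn hne u.continuous.continuousOn
  obtain ⟨_, ⟨a, ⟨ha, haz⟩, rfl⟩, _, ⟨b, ⟨hb, hbz⟩, rfl⟩, hab⟩ :=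
    hi z hz ⟨hz, mem_vadd_range_smul.mpr ⟨0, by simp⟩⟩
  obtain ⟨s, hs⟩ := mem_vadd_range_smul.mp haz
  obtain ⟨t, ht⟩ := mem_vadd_range_smul.mp hbz
  have hle : ∀ a' ∈ A, ∀ b' ∈ B, α * u a' + β * u b' ≤ α * u a + β * u b := fun a' ha' b' hb' => by
    have := hmax (Set.add_mem_add (Set.smul_mem_smul_set ha') (Set.smul_mem_smul_set hb'))
    simpa [← hab] using this
  refine ⟨a, ha, b, hb, fun a' ha' => ?_, fun b' hb' => ?_, (s - t) * c, ?_⟩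
  · exact le_of_mul_le_mul_left (by linarith [hle a' ha' b hb]) hα
  · exact le_of_mul_le_mul_left (by linarith [hle a ha b' hb']) hβ
  · rw [hs, ht]
    module

end Auxiliary

/-- Claim about planar Minkowski combinations: if all chords of `C = αA + βB`
parallel to a line `l` through the origin decompose as Minkowski combinations of
the corresponding chords of `A` and `B`, and one chord is common to all three
bodies, then `A = B`. -/
theorem planar_sum_claim
    (w : EuclideanSpace ℝ (Fin 2)) (hw : w ≠ 0)
    (A B : Set (EuclideanSpace ℝ (Fin 2)))
    (hAc : IsCompact A) (hAcv : Convex ℝ A) (hAi : (interior A).Nonempty)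
    (hBc : IsCompact B) (hBcv : Convex ℝ B) (hBi : (interior B).Nonempty)
    (α β : ℝ) (hα : 0 < α) (hβ : 0 < β) (hαβ : α + β = 1)
    (hi : ∀ z ∈ α • A + β • B,
      (A ∩ (z +ᵥ Set.range fun t : ℝ => t • w)).Nonempty ∧
      (B ∩ (z +ᵥ Set.range fun t : ℝ => t • w)).Nonempty ∧
      (α • A + β • B) ∩ (z +ᵥ Set.range fun t : ℝ => t • w) =
        α • (A ∩ (z +ᵥ Set.range fun t : ℝ => t • w)) +
          β • (B ∩ (z +ᵥ Set.range fun t : ℝ => t • w)))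
    (hii : ∃ z ∈ α • A + β • B,
      (α • A + β • B) ∩ (z +ᵥ Set.range fun t : ℝ => t • w) =
          A ∩ (z +ᵥ Set.range fun t : ℝ => t • w) ∧
      A ∩ (z +ᵥ Set.range fun t : ℝ => t • w) =
          B ∩ (z +ᵥ Set.range fun t : ℝ => t • w)) :
    A = B := by
  have hne : (α • A + β • B).Nonempty := hii.imp fun _ h => h.1
  have hC : IsCompact (α • A + β • B) := (hAc.smul α).add (hBc.smul β)
  have hal : ∀ v, (∃ c : ℝ, w = c • v) → HasAlignedMaximizers v A B := fun v hv =>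
    hasAlignedMaximizers_of_chords hα hβ hC hne hv fun z hz => (hi z hz).2.2.subset
  have h := hal w ⟨1, by simp⟩
  have h' := hal (-w) ⟨-1, by simp⟩
  obtain ⟨z, hz, -, hAB⟩ := hii
  obtain ⟨y, hyA, hyl⟩ := (hi z hz).1
  have hyB : y ∈ B := (hAB.subset ⟨hyA, hyl⟩).1
  have hline : ∀ t : ℝ, y + t • w ∈ z +ᵥ Set.range fun t : ℝ => t • w := fun t => by
    obtain ⟨s, rfl⟩ := mem_vadd_range_smul.mp hyl
    exact mem_vadd_range_smul.mpr ⟨s + t, by module⟩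
  exact Set.Subset.antisymm
    (subset_of_hasAlignedMaximizers hw hAc hAcv hBc hBcv h h' hyB
      fun t ht => (hAB.subset ⟨ht, hline t⟩).1)
    (subset_of_hasAlignedMaximizers hw hBc hBcv hAc hAcv h.swap h'.swap hyA
      fun t ht => (hAB.superset ⟨ht, hline t⟩).1)
end
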